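/- If 1 < p ≤ q < ∞ and Banach spaces E and F contain complemented subspaces isomorphic to ℓ_p and ℓ_q respectively, then the quotient L(E;F)/L_K(E;F) does not have the approximation property. -/

import Mathlib

open scoped ENNReal

noncomputable section

/-- A normed space `E` has the approximation property if for every compact set `K` and `ε > 0`
there is a finite rank bounded operator `T : E → E` with `‖T x - x‖ < ε` on `K`. -/
def HasAP (𝕜 E : Type*) [NontriviallyNormedField 𝕜] [SeminormedAddCommGroup E]
    [NormedSpace 𝕜 E] : Prop :=
  ∀ K : Set E, IsCompact K → ∀ ε : ℝ, 0 < ε →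
    ∃ T : E →L[𝕜] E, FiniteDimensional 𝕜 (LinearMap.range (T : E →ₗ[𝕜] E)) ∧
      ∀ x ∈ K, ‖T x - x‖ < ε

namespace SzA

abbrev A (s : ℕ) : Type := Fin (s+4) → Bool
abbrev qq (s : ℕ) : ℝ := 2^(s+4)

def sg (b : Bool) : ℝ := if b then -1 else 1

def hh {n : ℕ} (b a : Fin n → Bool) : ℝ := ∏ i, sg (b i && a i)

lemma hh_symm {n : ℕ} (b a : Fin n → Bool) : hh b a = hh a b := by
  unfold hh; simp [Bool.and_comm]

lemma sg_sq (b : Bool) : sg b * sg b = 1 := by cases b <;> simp [sg]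

lemma hh_sq {n : ℕ} (b a : Fin n → Bool) : hh b a * hh b a = 1 := by
  unfold hh; rw [← Finset.prod_mul_distrib]; simp [sg_sq]

lemma hh_orth {n : ℕ} (a a' : Fin n → Bool) :
    ∑ b : Fin n → Bool, hh b a * hh b a' = if a = a' then (2:ℝ)^n else 0 := by
  split_ifs with h
  · subst h; simp [hh_sq]
  · have : ∀ b : Fin n → Bool, hh b a * hh b a' = ∏ i, (sg (b i && a i) * sg (b i && a' i)) := by
      intro b; unfold hh; rw [← Finset.prod_mul_distrib]
    simp_rw [this]
    have := (Finset.prod_univ_sum (fun _ : Fin n => (Finset.univ : Finset Bool))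
      (fun i x => sg (x && a i) * sg (x && a' i)))
    rw [Fintype.piFinset_univ] at this
    rw [← this]
    obtain ⟨i, hi⟩ := Function.ne_iff.mp h
    apply Finset.prod_eq_zero (Finset.mem_univ i)
    cases h1 : a i <;> cases h2 : a' i <;> simp_all [sg]

/-- Rademacher orthogonality. -/
lemma rad_orth {ι : Type*} [Fintype ι] [DecidableEq ι] (i j : ι) :
    ∑ ω : ι → Bool, sg (ω i) * sg (ω j) = if i = j then (2:ℝ)^(Fintype.card ι) else 0 := by
  split_ifs with h
  · subst h; simp [sg_sq]
  · apply Finset.sum_involution (fun ω _ => Function.update ω i (!(ω i)))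
    · intro ω _
      have : j ≠ i := fun h' => h h'.symm
      simp [Function.update_of_ne this]
      cases ω i <;> cases ω j <;> simp [sg]
    · intro ω _ _ h'
      have := congrFun h' i
      simp at this
    · intro ω _; simp
    · intro ω _; simp

variable {𝕜 : Type*} [RCLike 𝕜]

lemma parseval {α β : Type*} [Fintype α] [Fintype β] [DecidableEq α] (h : β → α → ℝ) (N : ℝ)
    (hN : ∀ a a', ∑ b, h b a * h b a' = if a = a' then N else 0) (X : α → 𝕜) :
    ∑ b, ‖∑ a, (h b a : 𝕜) * X a‖^2 = N * ∑ a, ‖X a‖^2 := by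
  have key : (((∑ b, ‖∑ a, (h b a : 𝕜) * X a‖^2 : ℝ)) : 𝕜) = ((N * ∑ a, ‖X a‖^2 : ℝ) : 𝕜) := by
    push_cast
    simp_rw [← RCLike.mul_conj, map_sum, Finset.sum_mul_sum, map_mul, RCLike.conj_ofReal]
    rw [Finset.sum_comm]
    rw [Finset.mul_sum]
    refine Finset.sum_congr rfl fun a _ => ?_
    rw [Finset.sum_comm]
    have : ∀ a', ∑ b, (h b a : 𝕜) * X a * ((h b a' : 𝕜) * (starRingEnd 𝕜) (X a')) =
        ((∑ b, h b a * h b a' : ℝ) : 𝕜) * (X a * (starRingEnd 𝕜) (X a')) := by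
      intro a'; push_cast; rw [Finset.sum_mul]
      refine Finset.sum_congr rfl fun b _ => ?_
      ring
    simp_rw [this, hN]
    rw [Finset.sum_eq_single a]
    · rw [if_pos rfl]
    · intro x _ hx
      rw [if_neg (Ne.symm hx)]; simp
    · simp
  exact_mod_cast key

lemma parseval_hh {n : ℕ} (X : (Fin n → Bool) → 𝕜) :
    ∑ b : Fin n → Bool, ‖∑ a, (hh b a : 𝕜) * X a‖^2 = 2^n * ∑ a, ‖X a‖^2 :=
  parseval hh _ hh_orth X

lemma parseval_hh' {n : ℕ} (X : (Fin n → Bool) → 𝕜) :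
    ∑ a : Fin n → Bool, ‖∑ b, (hh b a : 𝕜) * X b‖^2 = 2^n * ∑ a, ‖X a‖^2 := by
  rw [← parseval_hh X]
  refine Finset.sum_congr rfl fun a _ => ?_
  have : ∀ b, hh b a = hh a b := fun b => hh_symm b a
  simp_rw [this]

def Y (s : ℕ) : Type := GaloisField 2 (s+4)
instance (s : ℕ) : Field (Y s) := inferInstanceAs (Field (GaloisField 2 (s+4)))
instance (s : ℕ) : Finite (Y s) := inferInstanceAs (Finite (GaloisField 2 (s+4)))
instance (s : ℕ) : Fintype (Y s) := Fintype.ofFinite _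
instance (s : ℕ) : DecidableEq (Y s) := Classical.decEq _

lemma card_Y (s : ℕ) : Fintype.card (Y s) = 2^(s+4) := by
  rw [← Nat.card_eq_fintype_card]
  exact GaloisField.card 2 (s+4) (by omega)

abbrev Z (s : ℕ) : Type := A s × A (s+1) × Y s

lemma exists_f (s : ℕ) : ∃ f : Option (Z (s+1)) → A s → Y s, ∀ z z', z ≠ z' → ∀ c,
    (Finset.univ.filter (fun a => f z a - f z' a = c)).card ≤ 5 := by
  have e1 : Nonempty (A s ↪ Y s) := by
    apply Function.Embedding.nonempty_of_card_le
    rw [card_Y]; simp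
  have e2 : Nonempty (Option (Z (s+1)) ↪ (Fin 5 → Y s)) := by
    apply Function.Embedding.nonempty_of_card_le
    simp only [Fintype.card_option, Fintype.card_prod, Fintype.card_fun, Fintype.card_bool, Fintype.card_fin, card_Y]
    rw [← pow_add, ← pow_add, ← pow_mul]
    calc _ ≤ 2^(s+1+4+(s+1+1+4+(s+1+4))) + 2^(s+1+4+(s+1+1+4+(s+1+4))) := by
          gcongr; exact Nat.one_le_two_pow
      _ = 2^((s+1+4+(s+1+1+4+(s+1+4)))+1) := by ring
      _ ≤ _ := Nat.pow_le_pow_right (by norm_num) (by omega)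
  obtain ⟨e1⟩ := e1
  obtain ⟨e2⟩ := e2
  refine ⟨fun z a => ∑ i : Fin 5, e2 z i * (e1 a)^(i.val+1), fun z z' hz c => ?_⟩
  let P : Polynomial (Y s) := ∑ i : Fin 5, Polynomial.C (e2 z i - e2 z' i) * Polynomial.X^(i.val+1)
    - Polynomial.C c
  have hP : P ≠ 0 := by
    intro h0
    apply hz
    apply e2.injective
    funext i
    have h1 := congrArg (fun p => Polynomial.coeff p (i.val+1)) h0
    simp only [P, Polynomial.coeff_sub, Polynomial.finsetSum_coeff, Polynomial.coeff_C_mul,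
      Polynomial.coeff_X_pow, Polynomial.coeff_C_succ, Polynomial.coeff_zero] at h1
    rw [Finset.sum_eq_single i] at h1
    · simp at h1; exact sub_eq_zero.mp h1
    · intro j _ hj
      rw [if_neg]; · simp
      intro h'; apply hj; ext; omega
    · simp
  have hdeg : P.natDegree ≤ 5 := by
    apply (Polynomial.natDegree_sub_le _ _).trans
    simp only [Polynomial.natDegree_C, max_le_iff]
    refine ⟨?_, by omega⟩
    apply Polynomial.natDegree_sum_le_of_forall_le
    intro i _
    apply (Polynomial.natDegree_C_mul_X_pow_le _ _).trans
    omega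
  calc _ = ((Finset.univ.filter (fun a => ∑ i : Fin 5, e2 z i * (e1 a)^(i.val+1) - ∑ i : Fin 5, e2 z' i * (e1 a)^(i.val+1) = c)).map e1).card := by
        rw [Finset.card_map]
    _ ≤ P.roots.toFinset.card := by
        apply Finset.card_le_card
        intro y hy
        simp only [Finset.mem_map, Finset.mem_filter, Finset.mem_univ, true_and] at hy
        obtain ⟨a, ha, rfl⟩ := hy
        simp only [Multiset.mem_toFinset, Polynomial.mem_roots hP, Polynomial.IsRoot.def]
        simp only [P, Polynomial.eval_sub, Polynomial.eval_finsetSum, Polynomial.eval_mul,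
          Polynomial.eval_C, Polynomial.eval_pow, Polynomial.eval_X]
        rw [← ha, ← Finset.sum_sub_distrib, sub_eq_zero]
        refine Finset.sum_congr rfl fun i _ => ?_
        ring
    _ ≤ P.roots.card := Multiset.toFinset_card_le _
    _ ≤ P.natDegree := Polynomial.card_roots' _
    _ ≤ 5 := hdeg

def tw {s : ℕ} : Option (Z (s+1)) → A s → Y s := (exists_f s).choose
lemma tw_spec (s : ℕ) (z z' : Option (Z (s+1))) (h : z ≠ z') (c : Y s) :
    (Finset.univ.filter (fun a => tw z a - tw z' a = c)).card ≤ 5 :=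
  (exists_f s).choose_spec z z' h c

structure Blk (s : ℕ) where
  T : Type
  K : Type
  U : Type
  fT : Fintype T
  fK : Fintype K
  fU : Fintype U
  dT : DecidableEq T
  dK : DecidableEq K
  dU : DecidableEq U
  kn : T → K
  un : T → U
  sn : T → ℝ
  hd : K → A s
  zh : K → Option (Z s)

attribute [instance] Blk.fT Blk.fK Blk.fU Blk.dT Blk.dK Blk.dU

def base (s : ℕ) : Blk s where
  T := A s
  K := A s
  U := Unit
  fT := inferInstance
  fK := inferInstance
  fU := inferInstance
  dT := inferInstance
  dK := inferInstance
  dU := inferInstance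
  kn := id
  un := fun _ => ()
  sn := fun _ => 1
  hd := id
  zh := fun _ => none

def ext {s : ℕ} (b : Blk (s+1)) : Blk s where
  T := Z s × b.T
  K := Z s × b.U
  U := Y s × b.K
  fT := inferInstance
  fK := inferInstance
  fU := inferInstance
  dT := inferInstance
  dK := inferInstance
  dU := inferInstance
  kn := fun x => (x.1, b.un x.2)
  un := fun x => (x.1.2.2 - tw (b.zh (b.kn x.2)) x.1.1, b.kn x.2)
  sn := fun x => hh x.1.2.1 (b.hd (b.kn x.2)) * b.sn x.2
  hd := fun x => x.1.1
  zh := fun x => some x.1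

def blk : ℕ → (s : ℕ) → Blk s
  | 0, s => base s
  | n+1, s => ext (blk n (s+1))

lemma blk_inj (n s : ℕ) (t t' : (blk n s).T) (h1 : (blk n s).kn t = (blk n s).kn t')
    (h2 : (blk n s).un t = (blk n s).un t') : t = t' := by
  induction n generalizing s with
  | zero => exact h1
  | succ n ih =>
    obtain ⟨z, t⟩ := t
    obtain ⟨z', t'⟩ := t'
    have h1' := Prod.ext_iff.mp h1
    have h2' := Prod.ext_iff.mp h2
    exact Prod.ext h1'.1 (ih (s+1) t t' h2'.2 h1'.2)

lemma sn_sq (n s : ℕ) (t : (blk n s).T) : (blk n s).sn t * (blk n s).sn t = 1 := by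
  induction n generalizing s with
  | zero => simp [blk, base]
  | succ n ih =>
    obtain ⟨z, t⟩ := t
    have := ih (s+1) t
    show (hh z.2.1 _ * (blk n (s+1)).sn t) * (hh z.2.1 _ * (blk n (s+1)).sn t) = 1
    rw [mul_mul_mul_comm, hh_sq, this, one_mul]

end SzA

namespace SzA
variable {𝕜 : Type*} [RCLike 𝕜]

def Al (𝕜 : Type*) [RCLike 𝕜] {s : ℕ} (b : Blk s) (e : ℝ) : Prop := ∀ (a : A s) (η : b.U → 𝕜),
  ∑ κ, (if b.hd κ = a then ‖∑ t, if b.kn t = κ then (b.sn t : 𝕜) * η (b.un t) else 0‖^2 else 0)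
    ≤ e * ∑ w, ‖η w‖^2

def Be (𝕜 : Type*) [RCLike 𝕜] {s : ℕ} (b : Blk s) (e : ℝ) : Prop := ∀ (ζ : b.K → 𝕜),
  ∑ a, ∑ w, ‖∑ t, if b.un t = w ∧ b.hd (b.kn t) = a then (b.sn t : 𝕜) * ζ (b.kn t) else 0‖^2
    ≤ e * ∑ κ, ‖ζ κ‖^2

lemma sum_shift {s : ℕ} {M : Type*} [AddCommMonoid M] (g : Y s → M) (c : Y s) :
    ∑ y, g (y - c) = ∑ y, g y := 
  Fintype.sum_equiv (Equiv.subRight c) _ _ (fun _ => rfl)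

lemma ext_Al {s : ℕ} (b : Blk (s+1)) (e : ℝ) (hb : Be 𝕜 b e) :
    Al 𝕜 (ext b) (qq (s+1) * e) := by
  intro a η
  have key : ∀ (z : Z s) (w : b.U), (∑ t : Z s × b.T, if (t.1, b.un t.2) = (z, w) then
      ((hh t.1.2.1 (b.hd (b.kn t.2)) * b.sn t.2 : ℝ) : 𝕜) * η (t.1.2.2 - tw (b.zh (b.kn t.2)) t.1.1, b.kn t.2) else 0) =
      ∑ a', (hh z.2.1 a' : 𝕜) * ∑ t, if b.un t = w ∧ b.hd (b.kn t) = a' then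
        (b.sn t : 𝕜) * η (z.2.2 - tw (b.zh (b.kn t)) z.1, b.kn t) else 0 := by
    intro z w
    rw [Fintype.sum_prod_type, Finset.sum_eq_single z]
    · simp_rw [Finset.mul_sum]
      rw [Finset.sum_comm]
      refine Finset.sum_congr rfl fun t _ => ?_
      rw [Finset.sum_eq_single (b.hd (b.kn t))]
      · simp [mul_assoc]
      · intro a' _ h; rw [if_neg]; · simp
        exact fun h' => h h'.2.symm
      · simp
    · intro z' _ h
      refine Finset.sum_eq_zero fun t _ => if_neg ?_
      intro h'; exact h (Prod.ext_iff.mp h').1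
    · intro h; exact absurd (Finset.mem_univ _) h
  calc _ = ∑ x : Z s × b.U, (if x.1.1 = a then ‖∑ a', (hh x.1.2.1 a' : 𝕜) * ∑ t, if b.un t = x.2 ∧ b.hd (b.kn t) = a' then
        (b.sn t : 𝕜) * η (x.1.2.2 - tw (b.zh (b.kn t)) x.1.1, b.kn t) else 0‖^2 else 0) := by
        refine Finset.sum_congr rfl fun x _ => ?_
        rw [← key]; rfl
    _ = ∑ y : Y s, ∑ w, ∑ b' : A (s+1), ‖∑ a', (hh b' a' : 𝕜) * ∑ t, if b.un t = w ∧ b.hd (b.kn t) = a' then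
        (b.sn t : 𝕜) * η (y - tw (b.zh (b.kn t)) a, b.kn t) else 0‖^2 := by
        simp_rw [Fintype.sum_prod_type]
        rw [Finset.sum_eq_single a]
        · simp only [if_true]
          rw [Finset.sum_comm]
          refine Finset.sum_congr rfl fun y _ => ?_
          rw [Finset.sum_comm]
        · intro a' _ h; simp [h]
        · simp
    _ = qq (s+1) * ∑ y : Y s, ∑ a', ∑ w, ‖∑ t, if b.un t = w ∧ b.hd (b.kn t) = a' then
        (b.sn t : 𝕜) * η (y - tw (b.zh (b.kn t)) a, b.kn t) else 0‖^2 := by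
        rw [Finset.mul_sum]
        refine Finset.sum_congr rfl fun y _ => ?_
        rw [Finset.sum_comm (s := (Finset.univ : Finset (A (s+1)))) (t := (Finset.univ : Finset b.U)), Finset.mul_sum]
        refine Finset.sum_congr rfl fun w _ => ?_
        rw [parseval_hh]
    _ ≤ qq (s+1) * ∑ y : Y s, e * ∑ κ, ‖η (y - tw (b.zh κ) a, κ)‖^2 := by
        gcongr with y
        exact hb (fun κ => η (y - tw (b.zh κ) a, κ))
    _ = qq (s+1) * e * ∑ κ, ∑ y : Y s, ‖η (y, κ)‖^2 := by
        rw [← Finset.mul_sum, ← mul_assoc, Finset.sum_comm]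
        congr 1
        refine Finset.sum_congr rfl fun κ _ => ?_
        exact sum_shift (fun y => ‖η (y, κ)‖^2) _
    _ = _ := by
        rw [Finset.sum_comm, ← Fintype.sum_prod_type (fun x : Y s × b.K => ‖η x‖^2)]; rfl

lemma ext_Be {s : ℕ} (b : Blk (s+1)) (e : ℝ) (hb : Al 𝕜 b e) :
    Be 𝕜 (ext b) (qq (s+1) * e) := by
  intro ζ
  have key : ∀ (a : A s) (y0 : Y s) (κ : b.K), (∑ t : Z s × b.T, if (t.1.2.2 - tw (b.zh (b.kn t.2)) t.1.1, b.kn t.2) = (y0 - tw (b.zh κ) a, κ) ∧ t.1.1 = a then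
      ((hh t.1.2.1 (b.hd (b.kn t.2)) * b.sn t.2 : ℝ) : 𝕜) * ζ (t.1, b.un t.2) else 0) =
      ∑ t, if b.kn t = κ then (b.sn t : 𝕜) * ∑ b', (hh b' (b.hd κ) : 𝕜) * ζ ((a, b', y0), b.un t) else 0 := by
    intro a y0 κ
    rw [Fintype.sum_prod_type, Finset.sum_comm]
    refine Finset.sum_congr rfl fun t _ => ?_
    simp_rw [Fintype.sum_prod_type]
    rw [Finset.sum_eq_single a]
    · split_ifs with h
      · rw [Finset.mul_sum]
        refine Finset.sum_congr rfl fun b' _ => ?_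
        rw [Finset.sum_eq_single y0]
        · simp [h]; ring
        · intro y _ hy
          apply if_neg
          simp [h, hy]
        · simp
      · refine Finset.sum_eq_zero fun b' _ => Finset.sum_eq_zero fun y _ => if_neg ?_
        simp [h]
    · intro a' _ h
      refine Finset.sum_eq_zero fun b' _ => Finset.sum_eq_zero fun y _ => if_neg ?_
      simp [h]
    · simp
  calc _ = ∑ a : A s, ∑ κ : b.K, ∑ y0 : Y s, ‖∑ t : Z s × b.T, if (t.1.2.2 - tw (b.zh (b.kn t.2)) t.1.1, b.kn t.2) = (y0 - tw (b.zh κ) a, κ) ∧ t.1.1 = a then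
      ((hh t.1.2.1 (b.hd (b.kn t.2)) * b.sn t.2 : ℝ) : 𝕜) * ζ (t.1, b.un t.2) else 0‖^2 := by
        refine Finset.sum_congr rfl fun a _ => ?_
        show ∑ w : Y s × b.K, _ = _
        rw [Fintype.sum_prod_type, Finset.sum_comm]
        refine Finset.sum_congr rfl fun κ _ => ?_
        exact (sum_shift (fun y => ‖∑ t : Z s × b.T, if (t.1.2.2 - tw (b.zh (b.kn t.2)) t.1.1, b.kn t.2) = (y, κ) ∧ t.1.1 = a then
      ((hh t.1.2.1 (b.hd (b.kn t.2)) * b.sn t.2 : ℝ) : 𝕜) * ζ (t.1, b.un t.2) else 0‖^2) _).symm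
    _ = ∑ a : A s, ∑ y0 : Y s, ∑ a', ∑ κ, (if b.hd κ = a' then ‖∑ t, if b.kn t = κ then (b.sn t : 𝕜) * ∑ b', (hh b' a' : 𝕜) * ζ ((a, b', y0), b.un t) else 0‖^2 else 0) := by
        simp_rw [key]
        refine Finset.sum_congr rfl fun a _ => ?_
        rw [Finset.sum_comm]
        refine Finset.sum_congr rfl fun y _ => ?_
        rw [Finset.sum_comm]
        refine Finset.sum_congr rfl fun κ _ => ?_
        simp
    _ ≤ ∑ a : A s, ∑ y0 : Y s, ∑ a' : A (s+1), e * ∑ w, ‖∑ b', (hh b' a' : 𝕜) * ζ ((a, b', y0), w)‖^2 := by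
        gcongr with a _ y0 _ a' _
        exact hb a' (fun w => ∑ b', (hh b' a' : 𝕜) * ζ ((a, b', y0), w))
    _ = qq (s+1) * e * ∑ a : A s, ∑ y0 : Y s, ∑ w, ∑ b', ‖ζ ((a, b', y0), w)‖^2 := by
        simp_rw [Finset.mul_sum]
        refine Finset.sum_congr rfl fun a _ => Finset.sum_congr rfl fun y _ => ?_
        rw [Finset.sum_comm]
        refine Finset.sum_congr rfl fun w _ => ?_
        rw [← Finset.mul_sum, parseval_hh', ← Finset.mul_sum]
        ring
    _ = _ := by
        congr 1
        symm
        show ∑ x : Z s × b.U, ‖ζ x‖^2 = _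
        simp_rw [Fintype.sum_prod_type]
        refine Finset.sum_congr rfl fun a _ => ?_
        rw [Finset.sum_comm]
        refine Finset.sum_congr rfl fun y _ => ?_
        rw [Finset.sum_comm]

lemma base_Al (s : ℕ) : Al 𝕜 (base s) 1 := by
  intro a η
  show ∑ κ : A s, (if κ = a then ‖∑ t : A s, if t = κ then ((1:ℝ) : 𝕜) * η () else 0‖^2 else 0)
    ≤ 1 * ∑ w : Unit, ‖η w‖^2
  simp

lemma base_Be (s : ℕ) : Be 𝕜 (base s) 1 := by
  have : ∀ ζ : A s → 𝕜, ∑ a : A s, ∑ w : Unit, ‖∑ t : A s, if () = w ∧ t = a then ((1:ℝ) : 𝕜) * ζ t else 0‖^2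
    ≤ 1 * ∑ κ : A s, ‖ζ κ‖^2 := by intro ζ; simp
  exact this

def ecst : ℕ → ℕ → ℝ
  | 0, _ => 1
  | n+1, s => qq (s+1) * ecst n (s+1)

lemma ecst_pos (n s : ℕ) : 0 < ecst n s := by
  induction n generalizing s with
  | zero => simp [ecst]
  | succ n ih => have := ih (s+1); simp only [ecst]; positivity

lemma AlBe (n s : ℕ) : Al 𝕜 (blk n s) (ecst n s) ∧ Be 𝕜 (blk n s) (ecst n s) := by
  induction n generalizing s with
  | zero => exact ⟨base_Al s, base_Be s⟩
  | succ n ih => exact ⟨ext_Al _ _ (ih (s+1)).2, ext_Be _ _ (ih (s+1)).1⟩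

/-- number of points in a kn row and un row -/
lemma cnt (n s : ℕ) : (∀ κ, ∑ t, (if (blk n s).kn t = κ then (1:ℝ) else 0) = ecst n s) ∧
    (∀ w, ∑ t, (if (blk n s).un t = w then (1:ℝ) else 0) = qq s * ecst n s) := by
  induction n generalizing s with
  | zero => 
    constructor
    · have : ∀ κ : A s, ∑ t : A s, (if t = κ then (1:ℝ) else 0) = 1 := by intro κ; simp
      exact this
    · intro w; show ∑ t : A s, (if () = () then (1:ℝ) else 0) = qq s * 1; simp
  | succ n ih =>
    obtain ⟨i1, i2⟩ := ih (s+1)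
    constructor
    · rintro ⟨z, w⟩
      show ∑ t : Z s × (blk n (s+1)).T, (if (t.1, (blk n (s+1)).un t.2) = (z, w) then (1:ℝ) else 0) = _
      rw [Fintype.sum_prod_type, Finset.sum_eq_single z]
      · simp only [Prod.mk.injEq, true_and]; exact i2 w
      · intro z' _ h; simp [h]
      · simp
    · rintro ⟨(y : Y s), (κ : (blk n (s+1)).K)⟩
      show ∑ t : Z s × (blk n (s+1)).T, (if (t.1.2.2 - tw ((blk n (s+1)).zh ((blk n (s+1)).kn t.2)) t.1.1, (blk n (s+1)).kn t.2) = (y, κ) then (1:ℝ) else 0) = _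
      rw [Fintype.sum_prod_type]
      simp_rw [Fintype.sum_prod_type]
      have : ∀ (a : A s) (b : A (s+1)), ∑ x : Y s, ∑ t : (blk n (s+1)).T, (if (x - tw ((blk n (s+1)).zh ((blk n (s+1)).kn t)) a, (blk n (s+1)).kn t) = (y, κ) then (1:ℝ) else 0) = ecst n (s+1) := by
        intro a b
        rw [← i1 κ, Finset.sum_comm]
        refine Finset.sum_congr rfl fun t _ => ?_
        by_cases h : (blk n (s+1)).kn t = κ
        · simp [h, sub_eq_iff_eq_add]
        · simp [h]
      refine (Finset.sum_congr rfl fun a _ => Finset.sum_congr rfl fun b _ => this a b).trans ?_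
      simp [ecst, qq]

end SzA

namespace SzA
variable {𝕜 : Type*} [RCLike 𝕜]

lemma cs_sq {α : Type*} [Fintype α] (f g : α → 𝕜) :
    ‖∑ x, f x * g x‖^2 ≤ (∑ x, ‖f x‖^2) * ∑ x, ‖g x‖^2 := by
  calc ‖∑ x, f x * g x‖^2 ≤ (∑ x, ‖f x‖ * ‖g x‖)^2 := by
        gcongr
        apply (norm_sum_le _ _).trans
        simp
    _ ≤ _ := Finset.sum_mul_sq_le_sq_mul_sq _ _ _

def OpB {s : ℕ} (b : Blk s) (F : b.T → 𝕜) (C : ℝ) : Prop := ∀ (ξ : b.K → 𝕜) (η : b.U → 𝕜),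
  ‖∑ t, F t * ξ (b.kn t) * η (b.un t)‖^2 ≤ C * (∑ κ, ‖ξ κ‖^2) * ∑ w, ‖η w‖^2

lemma OpB_of_row {s : ℕ} (b : Blk s) (F : b.T → 𝕜) (C : ℝ)
    (h : ∀ η : b.U → 𝕜, ∑ κ, ‖∑ t, if b.kn t = κ then F t * η (b.un t) else 0‖^2 ≤ C * ∑ w, ‖η w‖^2) :
    OpB b F C := by
  intro ξ η
  have : ∑ t, F t * ξ (b.kn t) * η (b.un t) = ∑ κ, ξ κ * ∑ t, if b.kn t = κ then F t * η (b.un t) else 0 := by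
    simp_rw [Finset.mul_sum]
    rw [Finset.sum_comm]
    refine Finset.sum_congr rfl fun t _ => ?_
    rw [Finset.sum_eq_single (b.kn t)]
    · simp; ring
    · intro κ _ h; rw [if_neg (Ne.symm h)]; simp
    · simp
  rw [this]
  refine (cs_sq _ _).trans ?_
  calc _ ≤ (∑ κ, ‖ξ κ‖^2) * (C * ∑ w, ‖η w‖^2) := by gcongr; exact h η
    _ = _ := by ring

/-- masked sign function -/
lemma OpB_sn (k s : ℕ) (m : (blk k s).K → Prop) [DecidablePred m] :
    OpB (blk k s) (fun t => if m ((blk k s).kn t) then ((blk k s).sn t : 𝕜) else 0) (qq s * ecst k s) := by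
  apply OpB_of_row
  intro η
  have h := (AlBe (𝕜 := 𝕜) k s).1
  calc _ ≤ ∑ κ, ‖∑ t, if (blk k s).kn t = κ then ((blk k s).sn t : 𝕜) * η ((blk k s).un t) else 0‖^2 := by
        gcongr with κ _
        by_cases hm : m κ
        · apply le_of_eq; congr 1
          refine Finset.sum_congr rfl fun t _ => ?_
          by_cases hk : (blk k s).kn t = κ
          · simp [hk, hm]
          · simp [hk]
        · rw [Finset.sum_eq_zero]
          · simp
          · intro t _
            by_cases hk : (blk k s).kn t = κ
            · simp [hk, hm]
            · simp [hk]
    _ = ∑ a : A s, ∑ κ, (if (blk k s).hd κ = a then ‖∑ t, if (blk k s).kn t = κ then ((blk k s).sn t : 𝕜) * η ((blk k s).un t) else 0‖^2 else 0) := by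
        rw [Finset.sum_comm]
        simp
    _ ≤ ∑ a : A s, ecst k s * ∑ w, ‖η w‖^2 := by
        gcongr with a _
        exact h a η
    _ = _ := by simp; ring

def RC {s : ℕ} (b : Blk s) (F : b.T → 𝕜) (R : ℝ) : Prop :=
  (∀ κ, ∑ t, (if b.kn t = κ then ‖F t‖^2 else 0) ≤ R^2) ∧
  (∀ w, ∑ t, (if b.un t = w then ‖F t‖^2 else 0) ≤ R^2)

lemma RC_row (k s : ℕ) (F : (blk k s).T → 𝕜) (R : ℝ) (hR : 0 ≤ R) (h : RC (blk k s) F R) (w) :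
    ∑ t, (if (blk k s).un t = w then ‖F t‖ else 0) ≤ Real.sqrt (qq s * ecst k s) * R := by
  have h0 := (cnt k s).2 w
  have hp := ecst_pos k s
  refine (sq_le_sq₀ (by positivity) (by positivity)).mp ?_
  rw [mul_pow, Real.sq_sqrt (by positivity)]
  calc _ = (∑ t, (if (blk k s).un t = w then 1 else 0) * (if (blk k s).un t = w then ‖F t‖ else 0))^2 := by
        congr 1
        refine Finset.sum_congr rfl fun t _ => ?_
        split_ifs <;> simp
    _ ≤ (∑ t, (if (blk k s).un t = w then (1:ℝ) else 0)^2) * ∑ t, (if (blk k s).un t = w then ‖F t‖ else 0)^2 :=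
        Finset.sum_mul_sq_le_sq_mul_sq _ _ _
    _ ≤ (qq s * ecst k s) * R^2 := by
        have e1 : (∑ t, (if (blk k s).un t = w then (1:ℝ) else 0)^2) = qq s * ecst k s := by
          rw [← h0]
          refine Finset.sum_congr rfl fun t _ => ?_
          split_ifs <;> simp
        rw [e1]
        gcongr
        refine le_trans (le_of_eq ?_) (h.2 w)
        refine Finset.sum_congr rfl fun t _ => ?_
        split_ifs <;> simp

lemma card_T (k s : ℕ) : (Fintype.card (blk k s).T : ℝ) = Fintype.card (blk k s).U * (qq s * ecst k s) := by
  have : ∑ w, ∑ t, (if (blk k s).un t = w then (1:ℝ) else 0) = Fintype.card (blk k s).T := by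
    rw [Finset.sum_comm]; simp
  rw [← this]
  simp_rw [(cnt k s).2]
  simp

lemma sqrt_card (k s : ℕ) (R : ℝ) : Fintype.card (blk k s).U * (Real.sqrt (qq s * ecst k s) * R) =
    R * Fintype.card (blk k s).T / Real.sqrt (qq s * ecst k s) := by
  have hp := ecst_pos k s
  have h2 : 0 < Real.sqrt (qq s * ecst k s) := by positivity
  have h3 : Real.sqrt (qq s * ecst k s) * Real.sqrt (qq s * ecst k s) = qq s * ecst k s := Real.mul_self_sqrt (by positivity)
  rw [card_T, eq_div_iff h2.ne']
  calc _ = Fintype.card (blk k s).U * (Real.sqrt (qq s * ecst k s) * Real.sqrt (qq s * ecst k s)) * R := by ring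
    _ = _ := by rw [h3]; ring

lemma RC_sum (k s : ℕ) (F : (blk k s).T → 𝕜) (R : ℝ) (hR : 0 ≤ R) (h : RC (blk k s) F R) :
    ∑ t, ‖F t‖ ≤ R * Fintype.card (blk k s).T / Real.sqrt (qq s * ecst k s) := by
  rw [← sqrt_card]
  calc _ = ∑ w, ∑ t, (if (blk k s).un t = w then ‖F t‖ else 0) := by
        rw [Finset.sum_comm]; simp
    _ ≤ ∑ w : (blk k s).U, Real.sqrt (qq s * ecst k s) * R := by
        gcongr with w; exact RC_row k s F R hR h w
    _ = _ := by simp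

def lift {s : ℕ} {b : Blk (s+1)} (z : Z s) (F : b.T → 𝕜) : (ext b).T → 𝕜 :=
  fun x : Z s × b.T => if x.1 = z then (hh z.2.1 (b.hd (b.kn x.2)) : 𝕜) * F x.2 else 0

lemma norm_hh {n : ℕ} (b a : Fin n → Bool) : ‖(hh b a : 𝕜)‖ = 1 := by
  rw [RCLike.norm_ofReal]
  exact (abs_eq zero_le_one).mpr (mul_self_eq_one_iff.mp (hh_sq b a))

lemma lift_sum {s : ℕ} {b : Blk (s+1)} (z : Z s) (F : b.T → 𝕜) (G : Z s × b.T → 𝕜) :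
    ∑ t : Z s × b.T, lift (b := b) z F t * G t = ∑ t, F t * ((hh z.2.1 (b.hd (b.kn t)) : 𝕜) * G (z, t)) := by
  rw [Fintype.sum_prod_type, Finset.sum_eq_single z]
  · refine Finset.sum_congr rfl fun t _ => ?_
    simp [lift]; ring
  · intro z' _ h
    refine Finset.sum_eq_zero fun t _ => ?_
    simp [lift, h]
  · intro h; exact absurd (Finset.mem_univ _) h

lemma OpB_lift {s : ℕ} {b : Blk (s+1)} (z : Z s) (F : b.T → 𝕜) (C : ℝ) (hC : 0 ≤ C) (h : OpB b F C) :
    OpB (ext b) (lift z F) C := by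
  have : ∀ (ξ : Z s × b.U → 𝕜) (η : Y s × b.K → 𝕜),
    ‖∑ t : Z s × b.T, lift (b := b) z F t * ξ (t.1, b.un t.2) * η (t.1.2.2 - tw (b.zh (b.kn t.2)) t.1.1, b.kn t.2)‖^2
      ≤ C * (∑ κ, ‖ξ κ‖^2) * ∑ w, ‖η w‖^2 := by
    intro ξ η
    simp_rw [mul_assoc]
    rw [lift_sum z F (fun t => ξ (t.1, b.un t.2) * η (t.1.2.2 - tw (b.zh (b.kn t.2)) t.1.1, b.kn t.2))]
    have := h (fun κ => (hh z.2.1 (b.hd κ) : 𝕜) * η (z.2.2 - tw (b.zh κ) z.1, κ)) (fun w => ξ (z, w))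
    calc _ = ‖∑ t, F t * ((hh z.2.1 (b.hd (b.kn t)) : 𝕜) * η (z.2.2 - tw (b.zh (b.kn t)) z.1, b.kn t)) * ξ (z, b.un t)‖^2 := by
          congr 2; refine Finset.sum_congr rfl fun t _ => ?_
          ring
      _ ≤ _ := this
      _ ≤ C * (∑ x, ‖η x‖^2) * ∑ x, ‖ξ x‖^2 := by
          gcongr
          · rw [Fintype.sum_prod_type, Finset.sum_comm]
            gcongr with κ _
            simp only [norm_mul, norm_hh, one_mul]
            exact Finset.single_le_sum (f := fun y => ‖η (y, κ)‖^2) (fun _ _ => by positivity) (Finset.mem_univ _)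
          · rw [Fintype.sum_prod_type]
            exact Finset.single_le_sum (f := fun z => ∑ w, ‖ξ (z, w)‖^2) (fun _ _ => by positivity) (Finset.mem_univ _)
      _ = _ := by ring
  exact this

lemma RC_lift {s : ℕ} {b : Blk (s+1)} (z : Z s) (F : Z s × b.T → 𝕜) (R : ℝ) (h : RC (ext b) F R) :
    RC b (fun t => (hh z.2.1 (b.hd (b.kn t)) : 𝕜) * F (z, t)) R := by
  have h1 : ∀ κ : Z s × b.U, ∑ t : Z s × b.T, (if (t.1, b.un t.2) = κ then ‖F t‖^2 else 0) ≤ R^2 := h.1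
  have h2 : ∀ w : Y s × b.K, ∑ t : Z s × b.T, (if (t.1.2.2 - tw (b.zh (b.kn t.2)) t.1.1, b.kn t.2) = w then ‖F t‖^2 else 0) ≤ R^2 := h.2
  constructor
  · intro κ
    refine le_trans ?_ (h2 (z.2.2 - tw (b.zh κ) z.1, κ))
    rw [Fintype.sum_prod_type]
    refine le_trans ?_ (Finset.single_le_sum (f := fun z' : Z s => ∑ t, (if (z'.2.2 - tw (b.zh (b.kn t)) z'.1, b.kn t) = (z.2.2 - tw (b.zh κ) z.1, κ) then ‖F (z', t)‖^2 else 0)) (fun _ _ => by positivity) (Finset.mem_univ z))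
    apply Finset.sum_le_sum
    intro t _
    by_cases hk : b.kn t = κ
    · simp only [norm_mul, norm_hh, hk, one_mul]; simp
    · simp [hk]
  · intro w
    refine le_trans ?_ (h1 (z, w))
    rw [Fintype.sum_prod_type]
    refine le_trans ?_ (Finset.single_le_sum (f := fun z' : Z s => ∑ t, (if (z', b.un t) = (z, w) then ‖F (z', t)‖^2 else 0)) (fun _ _ => by positivity) (Finset.mem_univ z))
    apply Finset.sum_le_sum
    intro t _
    by_cases hk : b.un t = w
    · simp only [norm_mul, norm_hh, hk, one_mul]; simp
    · simp [hk]

end SzA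

namespace SzA
variable {𝕜 : Type*} [RCLike 𝕜]

abbrev Fam (𝕜 : Type*) (s : ℕ) := ∀ k, (blk k s).T → 𝕜

def lf {s : ℕ} (z : Z s) : Fam 𝕜 (s+1) →ₗ[𝕜] Fam 𝕜 s where
  toFun F k := match k with
    | 0 => 0
    | k+1 => lift (b := blk k (s+1)) z (F k)
  map_add' F G := by
    funext k t
    cases k with
    | zero => simp
    | succ k => 
      show lift (b := blk k (s+1)) z ((F + G) k) t = lift (b := blk k (s+1)) z (F k) t + lift (b := blk k (s+1)) z (G k) t
      simp only [lift, Pi.add_apply]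
      split_ifs <;> ring
  map_smul' c F := by
    funext k t
    cases k with
    | zero => simp
    | succ k => 
      show lift (b := blk k (s+1)) z ((c • F) k) t = c • lift (b := blk k (s+1)) z (F k) t
      simp only [lift, Pi.smul_apply, smul_eq_mul]
      split_ifs <;> ring

lemma lf_zero {s : ℕ} (z : Z s) (F : Fam 𝕜 (s+1)) : lf z F 0 = 0 := rfl
lemma lf_succ {s : ℕ} (z : Z s) (F : Fam 𝕜 (s+1)) (k : ℕ) :
    lf z F (k+1) = lift (b := blk k (s+1)) z (F k) := rfl

def v0 {s : ℕ} (ζ : Option (Z s)) : Fam 𝕜 s :=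
  fun k t => if (blk k s).zh ((blk k s).kn t) = ζ then ((blk k s).sn t : 𝕜) else 0

lemma v0_succ {s : ℕ} (ζ : Option (Z s)) (k : ℕ) (t : Z s × (blk k (s+1)).T) :
    v0 (𝕜 := 𝕜) ζ (k+1) t = if some t.1 = ζ then (hh t.1.2.1 ((blk k (s+1)).hd ((blk k (s+1)).kn t.2)) : 𝕜) * (blk k (s+1)).sn t.2 else 0 := by
  show (if some t.1 = ζ then ((hh t.1.2.1 ((blk k (s+1)).hd ((blk k (s+1)).kn t.2)) * (blk k (s+1)).sn t.2 : ℝ) : 𝕜) else 0) = _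
  push_cast; rfl

lemma v0_zero {s : ℕ} (ζ : Option (Z s)) (t : (blk 0 s).T) :
    v0 (𝕜 := 𝕜) ζ 0 t = if none = ζ then 1 else 0 := by
  show (if none = ζ then ((1 : ℝ) : 𝕜) else 0) = _
  simp

lemma v0_some {s : ℕ} (z : Z s) : v0 (𝕜 := 𝕜) (some z) = ∑ ζ, lf z (v0 ζ) := by
  funext k
  rw [Finset.sum_apply]
  cases k with
  | zero => 
    funext t
    rw [v0_zero]; simp [lf_zero]
  | succ k =>
    have : ∀ t : Z s × (blk k (s+1)).T, v0 (𝕜 := 𝕜) (some z) (k+1) t = (∑ ζ, lf (𝕜 := 𝕜) z (v0 ζ) (k+1)) t := by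
      rintro ⟨z0, t⟩
      refine (v0_succ _ _ _).trans ?_
      refine Eq.trans ?_ (Finset.sum_apply (M := fun _ : (blk (k+1) s).T => 𝕜) _ _ _).symm
      show _ = ∑ ζ, (if z0 = z then (hh z.2.1 ((blk k (s+1)).hd ((blk k (s+1)).kn t)) : 𝕜) * v0 (𝕜 := 𝕜) ζ k t else 0)
      simp_rw [v0]
      by_cases h : z0 = z
      · simp [h]
      · simp [h]
    funext t
    exact this t

def Pre : ℕ → ℕ → Type
  | 0, s => Option (Z s)
  | j+1, s => Option (Z s × Pre j (s+1))

instance instPre : (j s : ℕ) → Fintype (Pre j s)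
  | 0, s => inferInstanceAs (Fintype (Option (Z s)))
  | j+1, s => 
    let _ := instPre j (s+1)
    inferInstanceAs (Fintype (Option (Z s × Pre j (s+1))))

def vec : (j s : ℕ) → Pre j s → Fam 𝕜 s
  | 0, _, ζ => v0 ζ
  | _+1, _, none => v0 none
  | j+1, s, some (z, p) => lf z (vec j (s+1) p)

abbrev AB (s : ℕ) := A s × A (s+1)

def Lab : ℕ → ℕ → Type
  | 0, s => (AB s → Bool) × Option (Z (s+1)) × Y s
  | j+1, s => Z s × Lab j (s+1)

instance instLab : (j s : ℕ) → Fintype (Lab j s)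
  | 0, s => inferInstanceAs (Fintype ((AB s → Bool) × Option (Z (s+1)) × Y s))
  | j+1, s => 
    let _ := instLab j (s+1)
    inferInstanceAs (Fintype (Z s × Lab j (s+1)))

def zab {s : ℕ} (ζ : Option (Z (s+1))) (y : Y s) (c : AB s) : Z s := (c.1, c.2, y + tw ζ c.1)

def xv : (j s : ℕ) → Lab j s → Fam 𝕜 s
  | 0, _, (ε, ζ, y) => ∑ c, (sg (ε c) : 𝕜) • (v0 (some (zab ζ y c)) - lf (zab ζ y c) (v0 ζ))
  | j+1, s, (z, i) => lf z (xv j (s+1) i)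

def ov : (j s : ℕ) → Lab j s → Fam 𝕜 s
  | 0, _, (ε, ζ, y) => ∑ c, (sg (ε c) : 𝕜) • (lf (zab ζ y c) (v0 ζ))
  | j+1, s, (z, i) => lf z (ov j (s+1) i)

lemma rad_avg {M : Type*} [AddCommGroup M] [Module 𝕜 M] (b : M →ₗ[𝕜] M →ₗ[𝕜] 𝕜) {ι : Type*} [Fintype ι] [DecidableEq ι]
    (X W : ι → M) : ∑ ε : ι → Bool, b (∑ c, (sg (ε c) : 𝕜) • X c) (∑ c, (sg (ε c) : 𝕜) • W c) = 
      2^(Fintype.card ι) * ∑ c, b (X c) (W c) := by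
  simp_rw [map_sum, map_smul, LinearMap.sum_apply, LinearMap.smul_apply, smul_eq_mul, Finset.mul_sum]
  rw [Finset.sum_comm]
  refine Finset.sum_congr rfl fun c _ => ?_
  rw [Finset.sum_comm]
  have : ∀ c', ∑ ε : ι → Bool, (sg (ε c) : 𝕜) * ((sg (ε c') : 𝕜) * b (X c') (W c)) = 
     ((if c = c' then (2:ℝ)^(Fintype.card ι) else 0 : ℝ) : 𝕜) * b (X c') (W c) := by
    intro c'
    rw [← rad_orth c c']
    push_cast
    rw [Finset.sum_mul]
    refine Finset.sum_congr rfl fun ε _ => ?_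
    ring
  simp_rw [this]
  rw [Finset.sum_eq_single c]
  · rw [if_pos rfl]; push_cast; rfl
  · intro c' _ h; rw [if_neg (Ne.symm h)]; simp
  · simp

def NN (j s : ℕ) : ℕ := Fintype.card (AB (s+j))

lemma tele0 (s : ℕ) (b : Fam 𝕜 s →ₗ[𝕜] Fam 𝕜 s →ₗ[𝕜] 𝕜) :
    2^(Fintype.card (AB s)) * (∑ p : Option (Z s), b (v0 p) (v0 p) - (b (v0 none) (v0 none) +
      ∑ x : Z s × Option (Z (s+1)), b (lf x.1 (v0 x.2)) (lf x.1 (v0 x.2)))) = 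
      ∑ i : (AB s → Bool) × Option (Z (s+1)) × Y s, b (xv 0 s i) (ov 0 s i) := by
  have e1 : ∑ p : Option (Z s), b (v0 p) (v0 p) - (b (v0 none) (v0 none) +
      ∑ x : Z s × Option (Z (s+1)), b (lf x.1 (v0 x.2)) (lf x.1 (v0 x.2))) = 
      ∑ ζ : Option (Z (s+1)), ∑ z : Z s, b (v0 (some z) - lf z (v0 ζ)) (lf z (v0 ζ)) := by
    rw [Fintype.sum_option, Fintype.sum_prod_type (α₁ := Z s)]
    simp only [map_sub, LinearMap.sub_apply]
    rw [add_sub_add_left_eq_sub, Finset.sum_comm (γ := Option (Z (s+1))), ← Finset.sum_sub_distrib]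
    refine Finset.sum_congr rfl fun z _ => ?_
    rw [Finset.sum_sub_distrib, ← map_sum, ← v0_some]
  rw [e1, Fintype.sum_prod_type (α₁ := AB s → Bool), Finset.sum_comm (γ := AB s → Bool), Fintype.sum_prod_type (α₁ := Option (Z (s+1))), Finset.mul_sum]
  refine Finset.sum_congr rfl fun ζ _ => ?_
  simp only [xv, ov]
  simp_rw [rad_avg b]
  rw [← Finset.mul_sum]
  congr 1
  rw [Finset.sum_comm]
  simp_rw [Fintype.sum_prod_type]
  refine Finset.sum_congr rfl fun a _ => Finset.sum_congr rfl fun b' _ => ?_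
  simp only [zab]
  exact Fintype.sum_equiv (Equiv.subRight (tw ζ a)) _ _ (fun y => by simp)

lemma tele (j s : ℕ) (b : Fam 𝕜 s →ₗ[𝕜] Fam 𝕜 s →ₗ[𝕜] 𝕜) :
    2^(NN j s) * (∑ p : Pre j s, b (vec j s p) (vec j s p) - ∑ p : Pre (j+1) s, b (vec (j+1) s p) (vec (j+1) s p)) = 
      ∑ i : Lab j s, b (xv j s i) (ov j s i) := by
  induction j generalizing s with
  | zero => 
    refine Eq.trans ?_ (tele0 s b)
    congr 2
    show ∑ p : Option (Z s × Option (Z (s+1))), _ = _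
    rw [Fintype.sum_option]
    rfl
  | succ j ih =>
    have hN : NN (j+1) s = NN j (s+1) := by
      simp only [NN]; rw [show s + (j+1) = s+1+j by ring]
    have h1 : ∀ j, ∑ p : Pre (j+1) s, b (vec (j+1) s p) (vec (j+1) s p) =
      b (v0 none) (v0 none) + ∑ z : Z s, ∑ p : Pre j (s+1), (b.compl₁₂ (lf z) (lf z)) (vec j (s+1) p) (vec j (s+1) p) := by
      intro j
      show ∑ p : Option (Z s × Pre j (s+1)), _ = _
      rw [Fintype.sum_option, Fintype.sum_prod_type (α₁ := Z s)]
      rfl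
    rw [h1, h1, add_sub_add_left_eq_sub, ← Finset.sum_sub_distrib, Finset.mul_sum, hN]
    simp_rw [ih]
    show _ = ∑ x : Z s × Lab j (s+1), _
    rw [Fintype.sum_prod_type (α₁ := Z s)]
    rfl

end SzA

namespace SzA
variable {𝕜 : Type*} [RCLike 𝕜]

def ppi : ℕ → ℕ → ℝ
  | 0, _ => 1
  | j+1, s => qq (s+1) * ppi j (s+1)

lemma ppi_pos (j s : ℕ) : 0 < ppi j s := by
  induction j generalizing s with
  | zero => simp [ppi]
  | succ n ih => have := ih (s+1); simp only [ppi]; positivity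

lemma ppi_succ' (j s : ℕ) : ppi (j+1) s = ppi j s * qq (s+j+1) := by
  induction j generalizing s with
  | zero => simp [ppi]
  | succ n ih => 
    rw [ppi, ih (s+1), ppi, mul_assoc, show s+1+n+1 = s+(n+1)+1 by ring]

lemma ppi_ge (j s : ℕ) : (16:ℝ)^j ≤ ppi j s := by
  induction j generalizing s with
  | zero => simp [ppi]
  | succ n ih => 
    rw [pow_succ', ppi]
    have := ih (s+1)
    gcongr
    rw [qq, pow_add]; norm_num
    exact one_le_pow₀ (by norm_num)

def OpN {s : ℕ} (F : Fam 𝕜 s) (c : ℝ) : Prop := ∀ k, OpB (blk k s) (F k) (c * ecst k s)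

lemma OpB_zero {s : ℕ} (b : Blk s) (C : ℝ) (hC : 0 ≤ C) : OpB b (0 : b.T → 𝕜) C := by
  intro ξ η; simp; positivity

lemma OpN_lf {s : ℕ} (z : Z s) (F : Fam 𝕜 (s+1)) (c : ℝ) (hc : 0 ≤ c) (h : OpN F c) :
    OpN (lf z F) (c / qq (s+1)) := by
  intro k
  cases k with
  | zero => 
    rw [lf_zero]; apply OpB_zero
    have := ecst_pos 0 s
    positivity
  | succ k =>
    rw [lf_succ]
    have h1 : c / qq (s+1) * ecst (k+1) s = c * ecst k (s+1) := by
      rw [ecst]; field_simp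
    rw [h1]
    apply OpB_lift
    · have := ecst_pos k (s+1)
      positivity
    · exact h k

lemma OpN_v0 {s : ℕ} (ζ : Option (Z s)) : OpN (v0 (𝕜 := 𝕜) ζ) (qq s) := by
  intro k
  exact OpB_sn k s (fun κ => (blk k s).zh κ = ζ)

lemma vec_OpN (j k s : ℕ) (p : Pre j s) (hjk : j ≤ k) :
    vec (𝕜 := 𝕜) j s p k = 0 ∨ OpN (vec (𝕜 := 𝕜) j s p) (qq (s+j) / ppi j s) := by
  induction j generalizing s k with
  | zero => 
    right
    simp only [ppi, div_one, add_zero]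
    exact OpN_v0 _
  | succ j ih =>
    obtain ⟨k, rfl⟩ : ∃ k', k = k'+1 := ⟨k-1, by omega⟩
    match p with
    | none => 
      left
      have : ∀ t : Z s × (blk k (s+1)).T, v0 (𝕜 := 𝕜) (none : Option (Z s)) (k+1) t = 0 := by
        intro t
        exact (v0_succ _ _ _).trans (by simp)
      funext t
      exact this t
    | some (z, p) =>
      rcases ih k (s+1) p (by omega) with h | h
      · left
        show lf z (vec j (s+1) p) (k+1) = 0
        rw [lf_succ, h]
        funext t
        simp [lift]
        rfl
      · right
        have := OpN_lf z _ _ (by have := ppi_pos j (s+1); positivity) h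
        have e : qq (s+(j+1)) / ppi (j+1) s = qq (s+1+j) / ppi j (s+1) / qq (s+1) := by
          rw [ppi, show s + (j+1) = s+1+j by ring, div_div, mul_comm (qq (s+1))]
        rw [e]
        exact this

lemma norm_sn (k s : ℕ) (t : (blk k s).T) : ‖((blk k s).sn t : 𝕜)‖ = 1 := by
  rw [RCLike.norm_ofReal]
  exact (abs_eq zero_le_one).mpr (mul_self_eq_one_iff.mp (sn_sq k s t))

lemma sn_sq' (k s : ℕ) (t : (blk k s).T) : ((blk k s).sn t : 𝕜) * ((blk k s).sn t : 𝕜) = 1 := by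
  exact_mod_cast congrArg (fun x : ℝ => (x : 𝕜)) (sn_sq k s t)

lemma v0_part {s : ℕ} (k : ℕ) (t : (blk k s).T) : (∑ ζ, ‖v0 (𝕜 := 𝕜) ζ k t‖ = 1) ∧
    ∑ ζ, v0 (𝕜 := 𝕜) ζ k t * v0 ζ k t = 1 := by
  constructor
  · rw [Finset.sum_eq_single ((blk k s).zh ((blk k s).kn t))]
    · simp only [v0, if_true]; exact norm_sn k s t
    · intro ζ _ h; simp [v0, Ne.symm h]
    · simp
  · rw [Finset.sum_eq_single ((blk k s).zh ((blk k s).kn t))]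
    · simp only [v0, if_true]; exact sn_sq' k s t
    · intro ζ _ h; simp [v0, Ne.symm h]
    · simp

lemma hh_sq' {n : ℕ} (b a : Fin n → Bool) : (hh b a : 𝕜) * (hh b a : 𝕜) = 1 := by
  exact_mod_cast congrArg (fun x : ℝ => (x : 𝕜)) (hh_sq b a)

lemma sum_Pre {M : Type*} [AddCommMonoid M] (j s : ℕ) (g : Fam 𝕜 s → M) : ∑ p : Pre (j+1) s, g (vec (j+1) s p) = 
        g (v0 none) + ∑ z : Z s, ∑ p : Pre j (s+1), g (lf z (vec j (s+1) p)) := by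
  show ∑ p : Option (Z s × Pre j (s+1)), _ = _
  rw [Fintype.sum_option, Fintype.sum_prod_type (α₁ := Z s)]
  rfl

lemma vec_part (j k s : ℕ) (t : (blk k s).T) : (∑ p, ‖vec (𝕜 := 𝕜) j s p k t‖ = 1) ∧
    ∑ p, vec (𝕜 := 𝕜) j s p k t * vec j s p k t = 1 := by
  induction j generalizing s k with
  | zero => exact v0_part k t
  | succ j ih =>
    have h2 := sum_Pre j s (fun F : Fam 𝕜 s => ‖F k t‖)
    have h3 := sum_Pre j s (fun F : Fam 𝕜 s => F k t * F k t)
    rw [h2, h3]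
    cases k with
    | zero => 
      simp only [lf_zero]
      rw [v0_zero]
      simp
    | succ k =>
      have key : ∀ t : Z s × (blk k (s+1)).T, (‖v0 (𝕜 := 𝕜) (none : Option (Z s)) (k+1) t‖ + 
        ∑ z : Z s, ∑ p : Pre j (s+1), ‖lift (b := blk k (s+1)) z (vec (𝕜 := 𝕜) j (s+1) p k) t‖ = 1) ∧
        (v0 (𝕜 := 𝕜) (none : Option (Z s)) (k+1) t * v0 (𝕜 := 𝕜) (none : Option (Z s)) (k+1) t + 
        ∑ z : Z s, ∑ p : Pre j (s+1), lift (b := blk k (s+1)) z (vec (𝕜 := 𝕜) j (s+1) p k) t * lift (b := blk k (s+1)) z (vec (𝕜 := 𝕜) j (s+1) p k) t = 1) := by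
        rintro ⟨z0, t⟩
        have e0 : v0 (𝕜 := 𝕜) (none : Option (Z s)) (k+1) (z0, t) = 0 :=
          (v0_succ _ _ _).trans (by simp)
        rw [e0, norm_zero, zero_add, mul_zero, zero_add]
        obtain ⟨i1, i2⟩ := ih k (s+1) t
        constructor
        · rw [Finset.sum_eq_single z0]
          · simp only [lift, if_true, norm_mul, norm_hh, one_mul]; exact i1
          · intro z _ h; simp [lift, Ne.symm h]
          · intro h; exact absurd (Finset.mem_univ _) h
        · rw [Finset.sum_eq_single z0]
          · simp only [lift, if_true]
            rw [← i2]
            refine Finset.sum_congr rfl fun p _ => ?_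
            rw [mul_mul_mul_comm, hh_sq', one_mul]
          · intro z _ h; simp [lift, Ne.symm h]
          · intro h; exact absurd (Finset.mem_univ _) h
      exact key t

lemma ov_apply {s : ℕ} (ε : AB s → Bool) (ζ : Option (Z (s+1))) (y : Y s) (k : ℕ) (z : Z s) (t : (blk k (s+1)).T) :
    ov (𝕜 := 𝕜) 0 s (ε, ζ, y) (k+1) (z, t) = if z.2.2 = y + tw ζ z.1 ∧ (blk k (s+1)).zh ((blk k (s+1)).kn t) = ζ then
      (sg (ε (z.1, z.2.1)) : 𝕜) * ((hh z.2.1 ((blk k (s+1)).hd ((blk k (s+1)).kn t)) : 𝕜) * (blk k (s+1)).sn t) else 0 := by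
  have : ov (𝕜 := 𝕜) 0 s (ε, ζ, y) (k+1) (z, t) = ∑ c, (sg (ε c) : 𝕜) * 
      (if z = zab ζ y c then (hh (zab ζ y c).2.1 ((blk k (s+1)).hd ((blk k (s+1)).kn t)) : 𝕜) * v0 (𝕜 := 𝕜) ζ k t else 0) := by
    show (∑ c, (sg (ε c) : 𝕜) • (lf (zab ζ y c) (v0 ζ))) (k+1) (z, t) = _
    rw [Finset.sum_apply]
    refine (Finset.sum_apply (M := fun _ : (blk (k+1) s).T => 𝕜) _ _ _).trans ?_
    rfl
  rw [this, Finset.sum_eq_single (z.1, z.2.1)]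
  · by_cases h1 : z.2.2 = y + tw ζ z.1
    · have : z = zab ζ y (z.1, z.2.1) := by simp [zab, ← h1]
      rw [if_pos this]
      simp only [v0, zab, h1, true_and]
      split_ifs <;> simp
    · have : z ≠ zab ζ y (z.1, z.2.1) := by
        intro h; apply h1; conv_lhs => rw [h]
        rfl
      rw [if_neg this]
      simp [h1]
  · intro c _ hc
    rw [if_neg]; · simp
    intro h; apply hc
    rw [h]; rfl
  · intro h; exact absurd (Finset.mem_univ _) h

lemma xv_apply {s : ℕ} (ε : AB s → Bool) (ζ : Option (Z (s+1))) (y : Y s) (k : ℕ) (z : Z s) (t : (blk k (s+1)).T) :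
    xv (𝕜 := 𝕜) 0 s (ε, ζ, y) (k+1) (z, t) = if z.2.2 = y + tw ζ z.1 ∧ (blk k (s+1)).zh ((blk k (s+1)).kn t) ≠ ζ then
      (sg (ε (z.1, z.2.1)) : 𝕜) * ((hh z.2.1 ((blk k (s+1)).hd ((blk k (s+1)).kn t)) : 𝕜) * (blk k (s+1)).sn t) else 0 := by
  have : xv (𝕜 := 𝕜) 0 s (ε, ζ, y) (k+1) (z, t) = ∑ c, (sg (ε c) : 𝕜) * 
      (v0 (𝕜 := 𝕜) (some (zab ζ y c)) (k+1) (z, t) - if z = zab ζ y c then (hh (zab ζ y c).2.1 ((blk k (s+1)).hd ((blk k (s+1)).kn t)) : 𝕜) * v0 (𝕜 := 𝕜) ζ k t else 0) := by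
    show (∑ c, (sg (ε c) : 𝕜) • (v0 (some (zab ζ y c)) - lf (zab ζ y c) (v0 ζ)) : Fam 𝕜 s) (k+1) (z, t) = _
    rw [Finset.sum_apply]
    refine (Finset.sum_apply (M := fun _ : (blk (k+1) s).T => 𝕜) _ _ _).trans ?_
    rfl
  have e0 : ∀ c, v0 (𝕜 := 𝕜) (some (zab ζ y c)) (k+1) (z, t) = 
      if z = zab ζ y c then (hh z.2.1 ((blk k (s+1)).hd ((blk k (s+1)).kn t)) : 𝕜) * (blk k (s+1)).sn t else 0 := by
    intro c
    exact (v0_succ _ _ _).trans (by simp)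
  rw [this, Finset.sum_eq_single (z.1, z.2.1)]
  · rw [e0]
    by_cases h1 : z.2.2 = y + tw ζ z.1
    · have : z = zab ζ y (z.1, z.2.1) := by simp [zab, ← h1]
      rw [if_pos this, if_pos this]
      simp only [v0, zab, h1, true_and]
      by_cases h2 : (blk k (s+1)).zh ((blk k (s+1)).kn t) = ζ
      · simp only [h2, if_true, ne_eq, not_true_eq_false, if_false, sub_self, mul_zero]
      · simp only [h2, if_false, ne_eq, not_false_eq_true, if_true, mul_zero, sub_zero]
    · have : z ≠ zab ζ y (z.1, z.2.1) := by
        intro h; apply h1; conv_lhs => rw [h]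
        rfl
      rw [if_neg this, if_neg this]
      simp [h1]
  · intro c _ hc
    rw [e0]
    have : z ≠ zab ζ y c := by
      intro h; apply hc
      rw [h]; rfl
    rw [if_neg this, if_neg this]; simp
  · intro h; exact absurd (Finset.mem_univ _) h

lemma norm_sg (b : Bool) : ‖(sg b : 𝕜)‖ = 1 := by
  cases b <;> simp [sg]

end SzA

namespace SzA
variable {𝕜 : Type*} [RCLike 𝕜]

lemma count5 {s : ℕ} (ζ ζ' : Option (Z (s+1))) (h : ζ' ≠ ζ) (y : Y s) (g : Y s → ℝ) (hg : ∀ c, 0 ≤ g c) :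
    ∑ a : A s, g (y + tw ζ a - tw ζ' a) ≤ 5 * ∑ c, g c := by
  calc _ = ∑ c, ∑ a : A s, (if y + tw ζ a - tw ζ' a = c then g c else 0) := by
        rw [Finset.sum_comm]; simp
    _ = ∑ c, ((Finset.univ.filter (fun a => tw ζ a - tw ζ' a = c - y)).card : ℝ) * g c := by
        refine Finset.sum_congr rfl fun c _ => ?_
        rw [← Finset.sum_filter, Finset.sum_const, nsmul_eq_mul]
        congr 4
        ext a
        constructor
        · intro h; rw [← h]; ring
        · intro h; rw [add_sub_assoc, h]; ring
    _ ≤ ∑ c, 5 * g c := by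
        gcongr with c _
        · exact hg c
        · exact_mod_cast tw_spec s ζ ζ' h.symm (c - y)
    _ = _ := by rw [Finset.mul_sum]

lemma xv0_aux {s : ℕ} (B : Blk (s+1)) (e : ℝ) (he : 0 ≤ e) (hb : Be 𝕜 B e) (ε : AB s → Bool) (ζ : Option (Z (s+1))) (y : Y s)
    (x : Z s × B.T → 𝕜) (hx : ∀ z t, x (z, t) = if z.2.2 = y + tw ζ z.1 ∧ B.zh (B.kn t) ≠ ζ then
      (sg (ε (z.1, z.2.1)) : 𝕜) * ((hh z.2.1 (B.hd (B.kn t)) : 𝕜) * B.sn t) else 0) (η : Y s × B.K → 𝕜) :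
    ∑ κ : Z s × B.U, ‖∑ t : Z s × B.T, 
      if (t.1, B.un t.2) = κ then x t * η (t.1.2.2 - tw (B.zh (B.kn t.2)) t.1.1, B.kn t.2) else 0‖^2
      ≤ 5 * (qq (s+1) * e) * ∑ w, ‖η w‖^2 := by
  set η' : A s → B.K → 𝕜 := fun a κ => if B.zh κ ≠ ζ then η (y + tw ζ a - tw (B.zh κ) a, κ) else 0 with hη'
  have key : ∀ (a : A s) (b' : A (s+1)) (y0 : Y s) (w : B.U), ‖∑ t : Z s × B.T, 
      if (t.1, B.un t.2) = ((a, b', y0), w) then x t * η (t.1.2.2 - tw (B.zh (B.kn t.2)) t.1.1, B.kn t.2) else 0‖^2 =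
      if y0 = y + tw ζ a then ‖∑ a', (hh b' a' : 𝕜) * ∑ t, if B.un t = w ∧ B.hd (B.kn t) = a' then
        (B.sn t : 𝕜) * η' a (B.kn t) else 0‖^2 else 0 := by
    intro a b' y0 w
    have e1 : (∑ t : Z s × B.T, 
      if (t.1, B.un t.2) = ((a, b', y0), w) then x t * η (t.1.2.2 - tw (B.zh (B.kn t.2)) t.1.1, B.kn t.2) else 0) = 
      if y0 = y + tw ζ a then (sg (ε (a, b')) : 𝕜) * ∑ a', (hh b' a' : 𝕜) * ∑ t, if B.un t = w ∧ B.hd (B.kn t) = a' then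
        (B.sn t : 𝕜) * η' a (B.kn t) else 0 else 0 := by
      rw [Fintype.sum_prod_type (α₁ := Z s), Finset.sum_eq_single (a, b', y0)]
      · split_ifs with hy
        · simp_rw [Finset.mul_sum]
          rw [Finset.sum_comm]
          refine Finset.sum_congr rfl fun t _ => ?_
          rw [Finset.sum_eq_single (B.hd (B.kn t))]
          · rw [hx]
            simp only [hη', hy, true_and, and_true, Prod.mk.injEq]
            by_cases h1 : B.un t = w <;> by_cases h2 : B.zh (B.kn t) = ζ
            · simp [h2]
            · simp [h1, h2]; ring
            · simp [h1]
            · simp [h1]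
          · intro a' _ h; rw [if_neg]; · simp
            exact fun h' => h h'.2.symm
          · simp
        · refine Finset.sum_eq_zero fun t _ => ?_
          rw [hx]
          simp [hy]
      · intro z _ h
        refine Finset.sum_eq_zero fun t _ => if_neg ?_
        intro h'; exact h (Prod.ext_iff.mp h').1
      · intro h; exact absurd (Finset.mem_univ _) h
    rw [e1]
    split_ifs
    · rw [norm_mul, norm_sg, one_mul]
    · simp
  calc _ = ∑ a : A s, ∑ b' : A (s+1), ∑ w, ‖∑ a', (hh b' a' : 𝕜) * ∑ t, if B.un t = w ∧ B.hd (B.kn t) = a' then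
        (B.sn t : 𝕜) * η' a (B.kn t) else 0‖^2 := by
        rw [Fintype.sum_prod_type (α₁ := Z s), Fintype.sum_prod_type (α₁ := A s)]
        refine Finset.sum_congr rfl fun a _ => ?_
        rw [Fintype.sum_prod_type (α₁ := A (s+1))]
        refine Finset.sum_congr rfl fun b' _ => ?_
        rw [Finset.sum_comm]
        refine Finset.sum_congr rfl fun w _ => ?_
        simp_rw [key]
        simp
    _ = ∑ a : A s, qq (s+1) * ∑ a', ∑ w, ‖∑ t, if B.un t = w ∧ B.hd (B.kn t) = a' then
        (B.sn t : 𝕜) * η' a (B.kn t) else 0‖^2 := by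
        refine Finset.sum_congr rfl fun a _ => ?_
        rw [Finset.sum_comm, Finset.sum_comm (s := (Finset.univ : Finset (A (s+1)))) (t := (Finset.univ : Finset B.U)), Finset.mul_sum]
        refine Finset.sum_congr rfl fun w _ => ?_
        rw [parseval_hh]
    _ ≤ ∑ a : A s, qq (s+1) * (e * ∑ κ, ‖η' a κ‖^2) := by
        gcongr with a
        exact hb (η' a)
    _ = qq (s+1) * e * ∑ κ, ∑ a : A s, ‖η' a κ‖^2 := by
        rw [Finset.sum_comm, Finset.mul_sum]
        refine Finset.sum_congr rfl fun a _ => ?_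
        ring
    _ ≤ qq (s+1) * e * ∑ κ, 5 * ∑ c, ‖η (c, κ)‖^2 := by
        gcongr with κ _
        by_cases h : B.zh κ = ζ
        · simp [hη', h]; positivity
        · simp only [hη', ne_eq, h, not_false_eq_true, if_true]
          exact count5 ζ (B.zh κ) h y (fun c => ‖η (c, κ)‖^2) (fun c => by positivity)
    _ = _ := by
        rw [Fintype.sum_prod_type, Finset.sum_comm, ← Finset.mul_sum]
        ring

lemma xv0_OpB (k s : ℕ) (ε : AB s → Bool) (ζ : Option (Z (s+1))) (y : Y s) :
    OpB (blk (k+1) s) (xv (𝕜 := 𝕜) 0 s (ε, ζ, y) (k+1)) (5 * ecst (k+1) s) := by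
  apply OpB_of_row
  exact xv0_aux (blk k (s+1)) (ecst k (s+1)) (ecst_pos _ _).le (AlBe k (s+1)).2 ε ζ y _ 
    (fun z t => xv_apply ε ζ y k z t)

lemma xv_OpN (j s : ℕ) (i : Lab j s) : OpN (xv (𝕜 := 𝕜) j s i) (5 / ppi j s) := by
  induction j generalizing s with
  | zero => 
    obtain ⟨ε, ζ, y⟩ := i
    simp only [ppi, div_one]
    intro k
    cases k with
    | zero => 
      have : xv (𝕜 := 𝕜) 0 s (ε, ζ, y) 0 = 0 := by
        show (∑ c, (sg (ε c) : 𝕜) • (v0 (some (zab ζ y c)) - lf (zab ζ y c) (v0 ζ)) : Fam 𝕜 s) 0 = 0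
        rw [Finset.sum_apply]
        refine Finset.sum_eq_zero fun c _ => ?_
        funext t
        simp only [Pi.smul_apply, Pi.sub_apply, v0_zero, lf_zero]
        simp
      rw [this]
      exact OpB_zero _ _ (by have := ecst_pos 0 s; positivity)
    | succ k => exact xv0_OpB k s ε ζ y
  | succ j ih =>
    obtain ⟨z, i⟩ := i
    have := OpN_lf z _ _ (by have := ppi_pos j (s+1); positivity) (ih (s+1) i)
    rw [ppi, mul_comm, ← div_div]
    exact this

lemma ov0_bound (k s : ℕ) (G : (AB s → Bool) × Option (Z (s+1)) × Y s → Z s × (blk k (s+1)).T → 𝕜) (R : ℝ) (hR : 0 ≤ R)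
    (hG : ∀ i, RC (blk (k+1) s) (G i) R) : 
    ∑ i, ‖∑ t : Z s × (blk k (s+1)).T, ov (𝕜 := 𝕜) 0 s i (k+1) t * G i t‖ ≤ 
     2^(Fintype.card (AB s)) * (R * Fintype.card (blk (k+1) s).T / Real.sqrt (qq s * ecst (k+1) s)) := by
  rw [← sqrt_card]
  set Q := Real.sqrt (qq s * ecst (k+1) s) * R with hQ
  have key : ∀ ε ζ y, ‖∑ t : Z s × (blk k (s+1)).T, ov (𝕜 := 𝕜) 0 s (ε, ζ, y) (k+1) t * G (ε, ζ, y) t‖ ≤ 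
      ∑ κ : (blk k (s+1)).K, if (blk k (s+1)).zh κ = ζ then Q else 0 := by
    intro ε ζ y
    have hrow : ∀ w : Y s × (blk k (s+1)).K, ∑ t : Z s × (blk k (s+1)).T, (if (t.1.2.2 - tw ((blk k (s+1)).zh ((blk k (s+1)).kn t.2)) t.1.1, (blk k (s+1)).kn t.2) = w then ‖G (ε, ζ, y) t‖ else 0) ≤ Q :=
      RC_row (k+1) s _ R hR (hG (ε, ζ, y))
    calc _ ≤ ∑ t : Z s × (blk k (s+1)).T, ‖ov (𝕜 := 𝕜) 0 s (ε, ζ, y) (k+1) t * G (ε, ζ, y) t‖ := norm_sum_le _ _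
      _ ≤ ∑ t : Z s × (blk k (s+1)).T, ∑ κ : (blk k (s+1)).K, (if (blk k (s+1)).zh κ = ζ then 
          (if (t.1.2.2 - tw ((blk k (s+1)).zh ((blk k (s+1)).kn t.2)) t.1.1, (blk k (s+1)).kn t.2) = (y, κ) then ‖G (ε, ζ, y) t‖ else 0) else 0) := by
          apply Finset.sum_le_sum
          rintro ⟨z, t⟩ _
          rw [ov_apply]
          by_cases h : z.2.2 = y + tw ζ z.1 ∧ (blk k (s+1)).zh ((blk k (s+1)).kn t) = ζ
          · rw [if_pos h]
            rw [norm_mul, norm_mul, norm_mul, norm_sg, norm_hh, norm_sn, one_mul, one_mul, one_mul]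
            refine le_trans (le_of_eq ?_) (Finset.single_le_sum (fun κ _ => ?_) (Finset.mem_univ ((blk k (s+1)).kn t)))
            · rw [if_pos h.2, if_pos]
              simp [h.1, h.2]
            · positivity
          · rw [if_neg h]
            rw [zero_mul, norm_zero]
            positivity
      _ = ∑ κ : (blk k (s+1)).K, (if (blk k (s+1)).zh κ = ζ then ∑ t : Z s × (blk k (s+1)).T,
          (if (t.1.2.2 - tw ((blk k (s+1)).zh ((blk k (s+1)).kn t.2)) t.1.1, (blk k (s+1)).kn t.2) = (y, κ) then ‖G (ε, ζ, y) t‖ else 0) else 0) := by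
          rw [Finset.sum_comm]
          refine Finset.sum_congr rfl fun κ _ => ?_
          split_ifs
          · rfl
          · simp
      _ ≤ _ := by
          gcongr with κ _
          split_ifs
          · exact hrow (y, κ)
          · exact le_rfl
  show ∑ i : (AB s → Bool) × Option (Z (s+1)) × Y s, _ ≤ _
  rw [Fintype.sum_prod_type]
  calc _ ≤ ∑ ε : AB s → Bool, ∑ x : Option (Z (s+1)) × Y s, ∑ κ : (blk k (s+1)).K, (if (blk k (s+1)).zh κ = x.1 then Q else 0) := by
        gcongr with ε _ x _
        exact key ε x.1 x.2
    _ = 2^(Fintype.card (AB s)) * (Fintype.card (Y s × (blk k (s+1)).K) * Q) := by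
        simp_rw [Fintype.sum_prod_type (α₁ := Option (Z (s+1)))]
        have : ∑ ζ : Option (Z (s+1)), ∑ y : Y s, ∑ κ : (blk k (s+1)).K, (if (blk k (s+1)).zh κ = ζ then Q else 0) = 
          Fintype.card (Y s × (blk k (s+1)).K) * Q := by
          simp_rw [Finset.sum_const, ← Finset.smul_sum]
          rw [Finset.sum_comm]
          simp [mul_assoc]
        simp_rw [this]
        rw [Finset.sum_const]
        simp
    _ = _ := rfl

lemma ov_bound (j k s : ℕ) (G : Lab j s → (blk k s).T → 𝕜) (R : ℝ) (hR : 0 ≤ R)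
    (hG : ∀ i, RC (blk k s) (G i) R) : 
    ∑ i, ‖∑ t, ov (𝕜 := 𝕜) j s i k t * G i t‖ ≤ 
     2^(NN j s) * (R * Fintype.card (blk k s).T * Real.sqrt (ppi j s / (qq (s+j) * ecst k s))) := by
  induction j generalizing s k with
  | zero => 
    cases k with
    | zero => 
      have : ∀ i, ov (𝕜 := 𝕜) 0 s i 0 = 0 := by
        rintro ⟨ε, ζ, y⟩
        show (∑ c, (sg (ε c) : 𝕜) • (lf (zab ζ y c) (v0 ζ)) : Fam 𝕜 s) 0 = 0
        rw [Finset.sum_apply]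
        refine Finset.sum_eq_zero fun c _ => ?_
        funext t
        simp only [Pi.smul_apply, lf_zero]
        simp
      simp_rw [this]
      simp
      positivity
    | succ k => 
      refine le_trans (ov0_bound k s G R hR hG) (le_of_eq ?_)
      simp only [ppi, NN, add_zero]
      rw [Real.sqrt_div zero_le_one, Real.sqrt_one]
      ring
  | succ j ih =>
    cases k with
    | zero => 
      have : ∀ i, ov (𝕜 := 𝕜) (j+1) s i 0 = 0 := by
        rintro ⟨z, i⟩
        rfl
      simp_rw [this]
      simp
      positivity
    | succ k => 
      have hN : NN (j+1) s = NN j (s+1) := by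
        simp only [NN]; rw [show s + (j+1) = s+1+j by ring]
      show ∑ i : Z s × Lab j (s+1), _ ≤ _
      rw [Fintype.sum_prod_type (α₁ := Z s)]
      calc _ = ∑ z : Z s, ∑ i : Lab j (s+1), ‖∑ t, ov (𝕜 := 𝕜) j (s+1) i k t * 
            ((hh z.2.1 ((blk k (s+1)).hd ((blk k (s+1)).kn t)) : 𝕜) * G (z, i) (z, t))‖ := by
            refine Finset.sum_congr rfl fun z _ => Finset.sum_congr rfl fun i _ => ?_
            congr 1
            exact lift_sum (b := blk k (s+1)) z (ov (𝕜 := 𝕜) j (s+1) i k) (G (z, i))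
        _ ≤ ∑ z : Z s, 2^(NN j (s+1)) * (R * Fintype.card (blk k (s+1)).T * Real.sqrt (ppi j (s+1) / (qq (s+1+j) * ecst k (s+1)))) := by
            gcongr with z _
            exact ih k (s+1) _ (fun i => RC_lift (b := blk k (s+1)) z (G (z, i)) R (hG (z, i)))
        _ = _ := by
            rw [Finset.sum_const, hN]
            have h1 : (Fintype.card (blk (k+1) s).T : ℝ) = Fintype.card (Z s) * Fintype.card (blk k (s+1)).T := by
              have : Fintype.card (blk (k+1) s).T = Fintype.card (Z s × (blk k (s+1)).T) := rfl
              rw [this, Fintype.card_prod]; push_cast; rfl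
            have h2 : ppi (j+1) s / (qq (s+(j+1)) * ecst (k+1) s) = ppi j (s+1) / (qq (s+1+j) * ecst k (s+1)) := by
              rw [ppi, ecst, show s + (j+1) = s+1+j by ring]
              have := ecst_pos k (s+1)
              field_simp
            rw [h1, h2, nsmul_eq_mul, Finset.card_univ]
            ring

end SzA

namespace SzA
variable {𝕜 : Type*} [RCLike 𝕜]

lemma blk_nonempty (n s : ℕ) : Nonempty (blk n s).T := by
  induction n generalizing s with
  | zero => exact (inferInstance : Nonempty (A s))
  | succ n ih =>
    have := ih (s+1)
    have hz : Nonempty (Z s) := by unfold Z Y; infer_instance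
    exact (inferInstance : Nonempty (Z s × (blk n (s+1)).T))

lemma OpB_mono {s : ℕ} {b : Blk s} {F : b.T → 𝕜} {C C' : ℝ} (h : OpB b F C) (hC : C ≤ C') : OpB b F C' := by
  intro ξ η
  refine (h ξ η).trans ?_
  gcongr

lemma OpB_smul {s : ℕ} {b : Blk s} {F : b.T → 𝕜} {C : ℝ} (h : OpB b F C) (a : 𝕜) : OpB b (a • F) (‖a‖^2 * C) := by
  intro ξ η
  have : ∑ t, (a • F) t * ξ (b.kn t) * η (b.un t) = a * ∑ t, F t * ξ (b.kn t) * η (b.un t) := by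
    rw [Finset.mul_sum]; refine Finset.sum_congr rfl fun t _ => ?_
    simp; ring
  rw [this, norm_mul, mul_pow]
  calc _ ≤ ‖a‖^2 * (C * (∑ κ, ‖ξ κ‖^2) * ∑ w, ‖η w‖^2) := by gcongr; exact h ξ η
    _ = _ := by ring

def nrm (𝕜 : Type*) [RCLike 𝕜] : Fam 𝕜 0 →ₗ[𝕜] Fam 𝕜 0 where
  toFun F k := ((Real.sqrt (ecst k 0))⁻¹ : 𝕜) • F k
  map_add' F G := by funext k; simp
  map_smul' c F := by funext k; funext t; simp; ring

lemma nrm_OpB {F : Fam 𝕜 0} {c : ℝ} (h : OpN F c) (k : ℕ) : OpB (blk k 0) (nrm 𝕜 F k) c := by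
  have h1 := OpB_smul (h k) ((Real.sqrt (ecst k 0))⁻¹ : 𝕜)
  have hp := ecst_pos k 0
  have e : ‖((Real.sqrt (ecst k 0))⁻¹ : 𝕜)‖^2 * (c * ecst k 0) = c := by
    rw [norm_inv, RCLike.norm_ofReal, abs_of_nonneg (Real.sqrt_nonneg _), inv_pow, Real.sq_sqrt hp.le]
    field_simp
  rw [e] at h1
  exact h1

lemma vec_bdd (j s : ℕ) (p : Pre j s) : ∃ c, 0 ≤ c ∧ OpN (vec (𝕜 := 𝕜) j s p) c := by
  induction j generalizing s with
  | zero => exact ⟨qq s, by positivity, OpN_v0 _⟩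
  | succ j ih =>
    match p with
    | none => exact ⟨qq s, by positivity, OpN_v0 _⟩
    | some (z, p) =>
      obtain ⟨c, hc, h⟩ := ih (s+1) p
      exact ⟨c / qq (s+1), by positivity, OpN_lf z _ _ hc h⟩

section
variable {X : Type*} [SeminormedAddCommGroup X] [NormedSpace 𝕜 X]

def bil (ι : Fam 𝕜 0 →ₗ[𝕜] X) {k : ℕ} (Λ : X →ₗ[𝕜] ((blk k 0).T → 𝕜)) (D : X →ₗ[𝕜] X) :
    Fam 𝕜 0 →ₗ[𝕜] Fam 𝕜 0 →ₗ[𝕜] 𝕜 :=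
  LinearMap.mk₂ 𝕜 (fun F G => ∑ t, G k t * Λ (D (ι (nrm 𝕜 F))) t)
    (by intros; simp [mul_add, Finset.sum_add_distrib])
    (by intros; simp [Finset.mul_sum, mul_left_comm])
    (by intros; simp [add_mul, Finset.sum_add_distrib])
    (by intros; simp [Finset.mul_sum, mul_assoc])

lemma bil_apply (ι : Fam 𝕜 0 →ₗ[𝕜] X) {k : ℕ} (Λ : X →ₗ[𝕜] ((blk k 0).T → 𝕜)) (D : X →ₗ[𝕜] X) (F G) :
    bil ι Λ D F G = ∑ t, G k t * Λ (D (ι (nrm 𝕜 F))) t := rfl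

lemma RC_mono {s : ℕ} {b : Blk s} {F : b.T → 𝕜} {R R' : ℝ} (h : RC b F R) (h0 : 0 ≤ R) (hR : R ≤ R') : RC b F R' := by
  have : R^2 ≤ R'^2 := by gcongr
  exact ⟨fun κ => (h.1 κ).trans this, fun κ => (h.2 κ).trans this⟩

lemma sqrt_q (j : ℕ) : Real.sqrt (1 / qq (0+j)) ≤ (18/25)^j := by
  apply Real.sqrt_le_iff.mpr
  refine ⟨by positivity, ?_⟩
  rw [qq, zero_add, pow_add, ← pow_mul, mul_comm j 2, pow_mul]
  calc (1 / (2^j * 2^4) : ℝ) ≤ 1 / 2^j := by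
        gcongr
        have : (0:ℝ) < 2^j := by positivity
        linarith
    _ = (1/2)^j := by simp
    _ ≤ _ := by gcongr; norm_num

lemma sum_nine (n : ℕ) : ∑ j ∈ Finset.range n, (9/10 : ℝ)^j ≤ 10 := by
  rw [geom_sum_eq (by norm_num)]
  have : (0:ℝ) ≤ (9/10)^n := by positivity
  rw [div_le_iff_of_neg (by norm_num)]
  linarith

theorem abstract_ap [T2Space X] (ι : Fam 𝕜 0 →ₗ[𝕜] X) (C₀ C : ℝ) (hC₀ : 0 ≤ C₀) (hC : 0 ≤ C)
    (hι : ∀ F c, 0 ≤ c → (∀ k, OpB (blk k 0) (F k) c) → ‖ι F‖ ≤ C₀ * Real.sqrt c)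
    (Λ : ∀ k, X →ₗ[𝕜] ((blk k 0).T → 𝕜)) (hΛ : ∀ k x, RC (blk k 0) (Λ k x) (C * ‖x‖))
    (hΛι : ∀ F c, 0 ≤ c → (∀ k, OpB (blk k 0) (F k) c) → ∀ k, Λ k (ι F) = F k) : ¬ HasAP 𝕜 X := by
  intro hAP
  set ν : Fam 𝕜 0 → X := fun F => ι (nrm 𝕜 F) with hν
  have hν1 : ∀ F c, 0 ≤ c → OpN F c → ‖ν F‖ ≤ C₀ * Real.sqrt c := fun F c hc h => hι _ c hc (nrm_OpB h)
  -- the compact set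
  let f : (Pre 0 0 ⊕ (Σ j, Lab j 0)) → X := fun x => match x with
    | .inl p => ν (vec 0 0 p)
    | .inr ⟨j, i⟩ => ((Real.sqrt (ppi j 0) * (4/5)^j : ℝ) : 𝕜) • ν (xv j 0 i)
  have hf : Filter.Tendsto f Filter.cofinite (nhds 0) := by
    rw [Metric.tendsto_nhds]
    intro δ hδ
    obtain ⟨n, hn⟩ := exists_pow_lt_of_lt_one (y := (4/5:ℝ)) (show 0 < δ / (C₀ * Real.sqrt 5 + 1) by positivity) (by norm_num)
    have hfin : (Set.range (Sum.inl : Pre 0 0 → Pre 0 0 ⊕ (Σ j, Lab j 0)) ∪ 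
      Set.range (fun x : (Σ j : Fin n, Lab j.val 0) => (Sum.inr ⟨x.1.val, x.2⟩ : Pre 0 0 ⊕ (Σ j, Lab j 0)))).Finite :=
      (Set.finite_range _).union (Set.finite_range _)
    rw [Filter.eventually_cofinite]
    refine hfin.subset ?_
    rintro (p | ⟨j, i⟩) hx
    · left; exact ⟨p, rfl⟩
    · right
      by_contra hcon
      apply hx
      have hj : n ≤ j := by
        by_contra hlt
        exact hcon ⟨⟨⟨j, by omega⟩, i⟩, rfl⟩
      rw [dist_zero_right]
      show ‖((Real.sqrt (ppi j 0) * (4/5)^j : ℝ) : 𝕜) • ν (xv j 0 i)‖ < δ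
      have hp := ppi_pos j 0
      have hx := hν1 _ _ (by positivity) (xv_OpN (𝕜 := 𝕜) j 0 i)
      rw [norm_smul, RCLike.norm_ofReal, abs_of_nonneg (by positivity)]
      calc _ ≤ Real.sqrt (ppi j 0) * (4/5)^j * (C₀ * Real.sqrt (5 / ppi j 0)) := by gcongr
        _ = (4/5)^j * (C₀ * Real.sqrt 5) := by
          rw [Real.sqrt_div (by norm_num)]
          have : 0 < Real.sqrt (ppi j 0) := by positivity
          field_simp
        _ ≤ (4/5)^n * (C₀ * Real.sqrt 5 + 1) := by
          gcongr ?_ * ?_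
          · exact pow_le_pow_of_le_one (by norm_num) (by norm_num) hj
          · linarith
        _ < δ := by rwa [lt_div_iff₀ (by positivity)] at hn
  have hcomp := hf.isCompact_insert_range_of_cofinite
  set P : ℝ := Fintype.card (Pre 0 0) + 10 with hP
  have hPpos : 0 < P := by positivity
  obtain ⟨T, hT, hTK⟩ := hAP _ hcomp (1 / (2 * (C+1) * P)) (by positivity)
  set ε : ℝ := 1 / (2 * (C+1) * P) with hε
  have hεpos : 0 < ε := by positivity
  let D : X →ₗ[𝕜] X := (T : X →ₗ[𝕜] X) - LinearMap.id
  have hD : ∀ x, ‖D (f x)‖ ≤ ε := by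
    intro x
    exact (hTK (f x) (Set.mem_insert_of_mem _ ⟨x, rfl⟩)).le
  -- step k
  let tot : ℕ → ℝ := fun k => Fintype.card (blk k 0).T / Real.sqrt (ecst k 0)
  have htot : ∀ k x, ∑ t, ‖Λ k x t‖ ≤ C * ‖x‖ * tot k := by
    intro k x
    refine (RC_sum k 0 _ _ (by positivity) (hΛ k x)).trans ?_
    have := ecst_pos k 0
    simp only [tot]
    rw [mul_div_assoc]
    gcongr
    have : (1:ℝ) ≤ qq 0 := by norm_num [qq]
    nlinarith
  have hnv : ∀ j k p t, ‖vec (𝕜 := 𝕜) j 0 p k t‖ ≤ 1 := by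
    intro j k p t
    rw [← (vec_part (𝕜 := 𝕜) j k 0 t).1]
    exact Finset.single_le_sum (f := fun p => ‖vec (𝕜 := 𝕜) j 0 p k t‖) (fun _ _ => by positivity) (Finset.mem_univ p)
  have hid : ∀ j k, ∑ p : Pre j 0, bil ι (Λ k) LinearMap.id (vec j 0 p) (vec j 0 p) = (tot k : 𝕜) := by
    intro j k
    have : ∀ p : Pre j 0, bil ι (Λ k) LinearMap.id (vec j 0 p) (vec j 0 p) = 
       ((Real.sqrt (ecst k 0))⁻¹ : 𝕜) * ∑ t, vec (𝕜 := 𝕜) j 0 p k t * vec (𝕜 := 𝕜) j 0 p k t := by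
      intro p
      obtain ⟨c, hc, h⟩ := vec_bdd (𝕜 := 𝕜) j 0 p
      rw [bil_apply, LinearMap.id_apply, hΛι _ c hc (nrm_OpB h), Finset.mul_sum]
      refine Finset.sum_congr rfl fun t _ => ?_
      simp [nrm]; ring
    simp_rw [this]
    rw [← Finset.mul_sum, Finset.sum_comm]
    simp_rw [(vec_part j k 0 _).2]
    simp [tot]; ring
  have hd0 : ∀ k, ‖∑ p : Pre 0 0, bil ι (Λ k) D (vec 0 0 p) (vec 0 0 p)‖ ≤ Fintype.card (Pre 0 0) * (C * ε * tot k) := by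
    intro k
    refine (norm_sum_le _ _).trans ?_
    calc _ ≤ ∑ p : Pre 0 0, C * ε * tot k := by
          gcongr with p _
          rw [bil_apply]
          refine (norm_sum_le _ _).trans ?_
          calc _ ≤ ∑ t, ‖Λ k (D (ν (vec 0 0 p))) t‖ := by
                gcongr with t
                rw [norm_mul]
                exact mul_le_of_le_one_left (norm_nonneg _) (hnv 0 k p t)
            _ ≤ _ := htot k _
            _ ≤ _ := by
                have : 0 ≤ tot k := by positivity
                gcongr
                exact hD (.inl p)
      _ = _ := by simp
  have hstep : ∀ j k, ‖∑ p : Pre j 0, bil ι (Λ k) D (vec j 0 p) (vec j 0 p) - 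
      ∑ p : Pre (j+1) 0, bil ι (Λ k) D (vec (j+1) 0 p) (vec (j+1) 0 p)‖ ≤ (9/10)^j * (C * ε * tot k) := by
    intro j k
    have ht := congrArg norm (tele j 0 (bil ι (Λ k) D))
    have hp := ppi_pos j 0
    have hek := ecst_pos k 0
    set R := C * (ε / (Real.sqrt (ppi j 0) * (4/5)^j)) with hR
    have hRp : 0 ≤ R := by positivity
    have hb := ov_bound j k 0 (fun i => Λ k (D (ν (xv j 0 i)))) R hRp (by
      intro i
      refine RC_mono (hΛ k _) (by positivity) ?_
      rw [hR]
      gcongr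
      have := hD (.inr ⟨j, i⟩)
      change ‖D (((Real.sqrt (ppi j 0) * (4/5)^j : ℝ) : 𝕜) • ν (xv j 0 i))‖ ≤ ε at this
      rw [map_smul, norm_smul, RCLike.norm_ofReal, abs_of_nonneg (by positivity)] at this
      rw [le_div_iff₀ (by positivity), mul_comm]
      exact this)
    rw [norm_mul, norm_pow, RCLike.norm_ofNat] at ht
    have h3 : (2:ℝ)^(NN j 0) * ‖∑ p : Pre j 0, bil ι (Λ k) D (vec j 0 p) (vec j 0 p) - 
      ∑ p : Pre (j+1) 0, bil ι (Λ k) D (vec (j+1) 0 p) (vec (j+1) 0 p)‖ ≤ 2^(NN j 0) * (R * Fintype.card (blk k 0).T * Real.sqrt (ppi j 0 / (qq (0+j) * ecst k 0))) := by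
      rw [ht]
      exact (norm_sum_le _ _).trans hb
    have h4 := le_of_mul_le_mul_left h3 (by positivity)
    refine h4.trans ?_
    have e1 : Real.sqrt (ppi j 0 / (qq (0+j) * ecst k 0)) = Real.sqrt (ppi j 0) * Real.sqrt (1 / qq (0+j)) / Real.sqrt (ecst k 0) := by
      rw [← Real.sqrt_mul hp.le, ← Real.sqrt_div (by positivity)]
      congr 1
      field_simp
    rw [e1]
    have hsp : 0 < Real.sqrt (ppi j 0) := by positivity
    have hse : 0 < Real.sqrt (ecst k 0) := by positivity
    calc _ = C * ε * tot k * (((4/5)^j)⁻¹ * Real.sqrt (1 / qq (0+j))) := by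
          simp only [hR, tot]; field_simp
      _ ≤ C * ε * tot k * (((4/5)^j)⁻¹ * (18/25)^j) := by
          have : 0 ≤ tot k := by positivity
          gcongr
          exact sqrt_q j
      _ = _ := by
          rw [← inv_pow, ← mul_pow]; norm_num; ring
  have hall : ∀ j k, ‖∑ p : Pre j 0, bil ι (Λ k) D (vec j 0 p) (vec j 0 p)‖ ≤ 
      (Fintype.card (Pre 0 0) + ∑ i ∈ Finset.range j, (9/10:ℝ)^i) * (C * ε * tot k) := by
    intro j k
    induction j with
    | zero => simpa using hd0 k
    | succ j ih =>
      have h1 := hstep j k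
      rw [norm_sub_rev] at h1
      have h2 := norm_le_norm_add_norm_sub' (∑ p : Pre (j+1) 0, bil ι (Λ k) D (vec (j+1) 0 p) (vec (j+1) 0 p)) (∑ p : Pre j 0, bil ι (Λ k) D (vec j 0 p) (vec j 0 p))
      rw [Finset.sum_range_succ]
      linarith
  have hlow : ∀ k, tot k / 2 ≤ ‖∑ p : Pre k 0, bil ι (Λ k) (T : X →ₗ[𝕜] X) (vec k 0 p) (vec k 0 p)‖ := by
    intro k
    have htk : 0 ≤ tot k := by positivity
    have h1 : ‖∑ p : Pre k 0, bil ι (Λ k) D (vec k 0 p) (vec k 0 p)‖ ≤ tot k / 2 := by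
      refine (hall k k).trans ?_
      calc _ ≤ P * (C * ε * tot k) := by
            gcongr
            rw [hP]; gcongr; exact sum_nine k
        _ ≤ P * ((C+1) * ε * tot k) := by gcongr; linarith
        _ = _ := by rw [hε]; field_simp
    have h2 : ∑ p : Pre k 0, bil ι (Λ k) (T : X →ₗ[𝕜] X) (vec k 0 p) (vec k 0 p) = 
        ∑ p : Pre k 0, bil ι (Λ k) D (vec k 0 p) (vec k 0 p) + (tot k : 𝕜) := by
      rw [← hid k k, ← Finset.sum_add_distrib]
      refine Finset.sum_congr rfl fun p _ => ?_
      simp only [bil_apply, D, ← Finset.sum_add_distrib]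
      refine Finset.sum_congr rfl fun t _ => ?_
      simp; ring
    rw [h2]
    have h3 := norm_sub_le_norm_add (∑ p : Pre k 0, bil ι (Λ k) D (vec k 0 p) (vec k 0 p)) (tot k : 𝕜)
    have h4 : ‖(tot k : 𝕜)‖ = tot k := by rw [RCLike.norm_ofReal, abs_of_nonneg htk]
    have h5 := norm_sub_norm_le (tot k : 𝕜) (-(∑ p : Pre k 0, bil ι (Λ k) D (vec k 0 p) (vec k 0 p)))
    rw [norm_neg, sub_neg_eq_add, add_comm (tot k : 𝕜)] at h5
    linarith
  -- finite rank
  let bb := Module.finBasis 𝕜 (LinearMap.range (T : X →ₗ[𝕜] X))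
  let T' : X →L[𝕜] (LinearMap.range (T : X →ₗ[𝕜] X)) := T.codRestrict _ (fun x => ⟨x, rfl⟩)
  let φ := fun i => (LinearMap.toContinuousLinearMap (bb.coord i)).comp T'
  have hTx : ∀ x, T x = ∑ i, φ i x • (bb i : X) := by
    intro x
    have h1 := congrArg Subtype.val (bb.sum_repr (T' x))
    rw [Submodule.coe_sum] at h1
    exact h1.symm
  set W : ℝ := ∑ i, ‖φ i‖ * (C * ‖(bb i : X)‖) with hW
  have hWn : 0 ≤ W := by positivity
  obtain ⟨m, hm⟩ := exists_pow_lt_of_lt_one (y := (1/4:ℝ)) (show 0 < 1 / (2 * (C₀ * W + 1)) by positivity) (by norm_num)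
  have hl := hlow (m+1)
  have hν2 : ∀ p : Pre (m+1) 0, vec (𝕜 := 𝕜) (m+1) 0 p (m+1) = 0 ∨ ‖ν (vec (m+1) 0 p)‖ ≤ C₀ * (1/4)^m := by
    intro p
    rcases vec_OpN (𝕜 := 𝕜) (m+1) (m+1) 0 p le_rfl with h | h
    · left; exact h
    · right
      have hp := ppi_pos m 0
      have hp' := ppi_pos (m+1) 0
      have hqp : 0 < qq (0+m+1) := by unfold qq; positivity
      have e : qq (0+(m+1)) / ppi (m+1) 0 = 1 / ppi m 0 := by
        rw [ppi_succ', ← add_assoc]; field_simp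
      rw [e] at h
      refine (hν1 _ _ (by positivity) h).trans ?_
      gcongr
      apply Real.sqrt_le_iff.mpr
      refine ⟨by positivity, ?_⟩
      rw [← pow_mul, mul_comm m 2, pow_mul]
      calc _ ≤ 1 / (16:ℝ)^m := by gcongr; exact ppi_ge m 0
        _ = _ := by rw [← one_div_pow]; norm_num
  have hup : ‖∑ p : Pre (m+1) 0, bil ι (Λ (m+1)) (T : X →ₗ[𝕜] X) (vec (m+1) 0 p) (vec (m+1) 0 p)‖ ≤ C₀ * (1/4)^m * W * tot (m+1) := by
    refine (norm_sum_le _ _).trans ?_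
    calc _ ≤ ∑ p : Pre (m+1) 0, ∑ i, ∑ t, ‖vec (𝕜 := 𝕜) (m+1) 0 p (m+1) t‖ * (C₀ * (1/4)^m * (‖φ i‖ * ‖Λ (m+1) (bb i : X) t‖)) := by
          gcongr with p _
          rcases hν2 p with h | h
          · rw [bil_apply, h]; simp
          · rw [bil_apply, Finset.sum_comm]
            refine (norm_sum_le _ _).trans ?_
            gcongr with t
            rw [norm_mul, ← Finset.mul_sum]
            gcongr
            change ‖Λ (m+1) (T (ν (vec (m+1) 0 p))) t‖ ≤ _
            rw [hTx, map_sum, Finset.sum_apply]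
            refine (norm_sum_le _ _).trans ?_
            gcongr with i
            rw [map_smul, Pi.smul_apply, norm_smul, ← mul_assoc]
            gcongr
            refine ((φ i).le_opNorm _).trans ?_
            rw [mul_comm]
            gcongr
      _ = ∑ i, C₀ * (1/4)^m * ‖φ i‖ * ∑ t, ‖Λ (m+1) (bb i : X) t‖ := by
          rw [Finset.sum_comm]
          refine Finset.sum_congr rfl fun i _ => ?_
          rw [Finset.sum_comm, Finset.mul_sum]
          refine Finset.sum_congr rfl fun t _ => ?_
          rw [← Finset.sum_mul, (vec_part (m+1) (m+1) 0 t).1]; ring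
      _ ≤ ∑ i, C₀ * (1/4)^m * ‖φ i‖ * (C * ‖(bb i : X)‖ * tot (m+1)) := by
          gcongr with i; exact htot _ _
      _ = _ := by
          rw [hW, Finset.mul_sum, Finset.sum_mul]
          refine Finset.sum_congr rfl fun i _ => ?_
          ring
  have htp : 0 < tot (m+1) := by
    have h1 := ecst_pos (m+1) 0
    have : 0 < Fintype.card (blk (m+1) 0).T := Fintype.card_pos_iff.mpr (blk_nonempty _ _)
    positivity
  have : C₀ * (1/4)^m * W < 1/2 := by
    rw [lt_div_iff₀ (by positivity)] at hm
    have : (0:ℝ) < (1/4)^m := by positivity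
    nlinarith
  nlinarith
end
end SzA

namespace SzA
variable {𝕜 : Type*} [RCLike 𝕜]

lemma rpow_le_exp (r : ℝ) (hr : 0 < r) : ∃ C : ℝ, 0 < C ∧ ∀ x : ℝ, 0 ≤ x → x ^ r ≤ C * Real.exp x := by
  refine ⟨1 + (⌈r⌉₊).factorial, by positivity, fun x hx => ?_⟩
  have h1 := Real.pow_div_factorial_le_exp x hx ⌈r⌉₊
  rw [div_le_iff₀ (by positivity)] at h1
  have h2 := Real.one_le_exp hx
  have h3 : x ^ r ≤ 1 + x ^ ⌈r⌉₊ := by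
    rcases le_total x 1 with h | h
    · have : x ^ r ≤ 1 := Real.rpow_le_one hx h hr.le
      have : 0 ≤ x ^ ⌈r⌉₊ := by positivity
      linarith
    · have : x ^ r ≤ x ^ (⌈r⌉₊ : ℝ) := Real.rpow_le_rpow_of_exponent_le h (Nat.le_ceil r)
      rw [Real.rpow_natCast] at this
      linarith
  nlinarith

lemma sum_exp_rad {U : Type} [Fintype U] [DecidableEq U] (a : U → ℝ) :
    ∑ ω : U → Bool, Real.exp (∑ u, sg (ω u) * a u) = ∏ u, (2 * Real.cosh (a u)) := by
  simp_rw [Real.exp_sum]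
  rw [← Fintype.prod_sum (f := fun u (b : Bool) => Real.exp (sg b * a u))]
  refine Finset.prod_congr rfl fun u _ => ?_
  rw [Fintype.sum_bool, Real.cosh_eq]
  simp [sg]; ring

lemma khin_real_one {U : Type} [Fintype U] [DecidableEq U] (a : U → ℝ) (ha : ∑ u, a u ^ 2 ≤ 1) :
    ∑ ω : U → Bool, Real.exp |∑ u, sg (ω u) * a u| ≤ 2 ^ Fintype.card U * 4 := by
  have key : ∀ a : U → ℝ, ∑ u, a u ^ 2 ≤ 1 → ∑ ω : U → Bool, Real.exp (∑ u, sg (ω u) * a u) ≤ 2 ^ Fintype.card U * 2 := by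
    intro a ha
    rw [sum_exp_rad, Finset.prod_mul_distrib]
    have h1 : ∏ u, Real.cosh (a u) ≤ Real.exp (1/2) := by
      calc _ ≤ ∏ u, Real.exp (a u ^ 2 / 2) := by
            refine Finset.prod_le_prod (fun i _ => (Real.cosh_pos _).le) fun u _ => ?_
            exact Real.cosh_le_exp_half_sq _
        _ = Real.exp ((∑ u, a u ^ 2) / 2) := by rw [← Real.exp_sum, Finset.sum_div]
        _ ≤ _ := by gcongr
    have h2 : Real.exp (1/2) ≤ 2 := by
      have h := Real.exp_one_lt_d9
      have : Real.exp (1/2) * Real.exp (1/2) = Real.exp 1 := by rw [← Real.exp_add]; norm_num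
      nlinarith [Real.exp_pos (1/2)]
    simp only [Finset.prod_const, Finset.card_univ]
    gcongr
    linarith
  have h1 := key a ha
  have h2 := key (fun u => - a u) (by simpa using ha)
  calc _ ≤ ∑ ω : U → Bool, (Real.exp (∑ u, sg (ω u) * a u) + Real.exp (∑ u, sg (ω u) * (- a u))) := by
        gcongr with ω
        have e : ∑ u, sg (ω u) * (- a u) = -∑ u, sg (ω u) * a u := by simp
        rw [e]
        rcases abs_cases (∑ u, sg (ω u) * a u) with h | h <;> rw [h.1]
        · linarith [Real.exp_pos (-∑ u, sg (ω u) * a u)]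
        · linarith [Real.exp_pos (∑ u, sg (ω u) * a u)]
    _ ≤ _ := by rw [Finset.sum_add_distrib]; linarith

lemma khin_real (r : ℝ) (hr : 0 < r) : ∃ C : ℝ, 0 < C ∧ ∀ (U : Type) [Fintype U] [DecidableEq U] (a : U → ℝ) (m : ℝ), 0 ≤ m → 
    ∑ u, a u ^ 2 ≤ m ^ 2 → ∑ ω : U → Bool, |∑ u, sg (ω u) * a u| ^ r ≤ 2 ^ Fintype.card U * C * m ^ r := by
  obtain ⟨C, hC, h⟩ := rpow_le_exp r hr
  refine ⟨C * 4, by positivity, fun U _ _ a m hm ha => ?_⟩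
  rcases hm.eq_or_lt with rfl | hm
  · have : ∀ u, a u = 0 := by
      intro u
      have h1 : a u ^ 2 ≤ ∑ u, a u ^ 2 := Finset.single_le_sum (f := fun u => a u ^ 2) (fun _ _ => by positivity) (Finset.mem_univ u)
      have h2 : a u ^ 2 ≤ 0 := by simpa using h1.trans ha
      exact pow_eq_zero_iff (two_ne_zero) |>.mp (le_antisymm h2 (by positivity))
    simp [this, Real.zero_rpow hr.ne']
  · have h1 := khin_real_one (fun u => a u / m) (by
      simp_rw [div_pow]; rw [← Finset.sum_div, div_le_one (by positivity)]; exact ha)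
    calc _ = ∑ ω : U → Bool, |∑ u, sg (ω u) * (a u / m)| ^ r * m ^ r := by
          refine Finset.sum_congr rfl fun ω _ => ?_
          rw [← Real.mul_rpow (abs_nonneg _) hm.le]
          congr 1
          rw [← abs_of_pos hm, ← abs_mul, abs_of_pos hm, Finset.sum_mul]
          congr 1
          refine Finset.sum_congr rfl fun u _ => ?_
          field_simp
      _ ≤ ∑ ω : U → Bool, (C * Real.exp |∑ u, sg (ω u) * (a u / m)|) * m ^ r := by
          gcongr with ω
          exact h _ (abs_nonneg _)
      _ ≤ _ := by
          rw [← Finset.sum_mul, ← Finset.mul_sum]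
          calc _ ≤ C * (2 ^ Fintype.card U * 4) * m ^ r := by gcongr
            _ = _ := by ring

lemma norm_le_ri (z : 𝕜) : ‖z‖ ≤ |RCLike.re z| + |RCLike.im z| := by
  have h := RCLike.norm_sq_eq_def (z := z)
  refine abs_le_of_sq_le_sq' ?_ (by positivity) |>.2
  rw [h]
  nlinarith [abs_mul_abs_self (RCLike.re z), abs_mul_abs_self (RCLike.im z), abs_nonneg (RCLike.re z), abs_nonneg (RCLike.im z), mul_nonneg (abs_nonneg (RCLike.re z)) (abs_nonneg (RCLike.im z))]

lemma khin (r : ℝ) (hr : 0 < r) : ∃ C : ℝ, 0 < C ∧ ∀ (U : Type) [Fintype U] [DecidableEq U] (a : U → 𝕜), 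
    ∑ ω : U → Bool, ‖∑ u, (sg (ω u) : 𝕜) * a u‖ ^ r ≤ 2 ^ Fintype.card U * (C * Real.sqrt (∑ u, ‖a u‖ ^ 2)) ^ r := by
  obtain ⟨C, hC, h⟩ := khin_real r hr
  refine ⟨2 * (2 * C) ^ (1/r), by positivity, fun U _ _ a => ?_⟩
  set m := Real.sqrt (∑ u, ‖a u‖ ^ 2) with hm
  have hm0 : 0 ≤ m := Real.sqrt_nonneg _
  have hm2 : m ^ 2 = ∑ u, ‖a u‖ ^ 2 := Real.sq_sqrt (by positivity)
  have h1 := h U (fun u => RCLike.re (a u)) m hm0 (by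
    rw [hm2]; refine Finset.sum_le_sum fun u _ => ?_; rw [← sq_abs]; gcongr; exact RCLike.abs_re_le_norm _)
  have h2 := h U (fun u => RCLike.im (a u)) m hm0 (by
    rw [hm2]; refine Finset.sum_le_sum fun u _ => ?_; rw [← sq_abs]; gcongr; exact RCLike.abs_im_le_norm _)
  calc _ ≤ ∑ ω : U → Bool, 2 ^ r * (|∑ u, sg (ω u) * RCLike.re (a u)| ^ r + |∑ u, sg (ω u) * RCLike.im (a u)| ^ r) := by
        gcongr with ω
        set z := ∑ u, (sg (ω u) : 𝕜) * a u with hz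
        have e1 : ∑ u, sg (ω u) * RCLike.re (a u) = RCLike.re z := by
          rw [hz, map_sum]; simp [RCLike.re_ofReal_mul]
        have e2 : ∑ u, sg (ω u) * RCLike.im (a u) = RCLike.im z := by
          rw [hz, map_sum]; simp [RCLike.im_ofReal_mul]
        rw [e1, e2]
        have hz1 := norm_le_ri z
        have p1 : 0 ≤ |RCLike.re z| ^ r := by positivity
        have p2 : 0 ≤ |RCLike.im z| ^ r := by positivity
        rcases le_total |RCLike.re z| |RCLike.im z| with hl | hl
        · calc _ ≤ (2 * |RCLike.im z|) ^ r := by gcongr; linarith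
            _ = 2 ^ r * |RCLike.im z| ^ r := Real.mul_rpow (by norm_num) (by positivity)
            _ ≤ _ := by gcongr; linarith
        · calc _ ≤ (2 * |RCLike.re z|) ^ r := by gcongr; linarith
            _ = 2 ^ r * |RCLike.re z| ^ r := Real.mul_rpow (by norm_num) (by positivity)
            _ ≤ _ := by gcongr; linarith
    _ ≤ 2 ^ r * (2 ^ Fintype.card U * C * m ^ r + 2 ^ Fintype.card U * C * m ^ r) := by
        rw [← Finset.mul_sum, Finset.sum_add_distrib]
        gcongr
    _ = _ := by
        rw [Real.mul_rpow (by positivity) hm0, Real.mul_rpow (by positivity) (by positivity), ← Real.rpow_mul (by positivity),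
          one_div_mul_cancel hr.ne', Real.rpow_one]
        ring

section
variable (U : Type) [Fintype U] [DecidableEq U]

/-- Rademacher synthesis. -/
def syn (𝕜 : Type*) [RCLike 𝕜] (r : ℝ) : (U → 𝕜) →ₗ[𝕜] ((U → Bool) → 𝕜) where
  toFun a ω := ((2 ^ (-(Fintype.card U : ℝ) / r) : ℝ) : 𝕜) * ∑ u, (sg (ω u) : 𝕜) * a u
  map_add' a b := by funext ω; simp [mul_add, Finset.sum_add_distrib]
  map_smul' c a := by
    funext ω; simp only [Pi.smul_apply, smul_eq_mul, RingHom.id_apply, Finset.mul_sum]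
    refine Finset.sum_congr rfl fun u _ => ?_
    ring

/-- Rademacher analysis. -/
def ana (𝕜 : Type*) [RCLike 𝕜] (r : ℝ) : ((U → Bool) → 𝕜) →ₗ[𝕜] (U → 𝕜) where
  toFun g u := ((2 ^ (-(Fintype.card U : ℝ) / r.conjExponent) : ℝ) : 𝕜) * ∑ ω : U → Bool, (sg (ω u) : 𝕜) * g ω
  map_add' a b := by funext ω; simp [mul_add, Finset.sum_add_distrib]
  map_smul' c a := by
    funext ω; simp only [Pi.smul_apply, smul_eq_mul, RingHom.id_apply, Finset.mul_sum]
    refine Finset.sum_congr rfl fun u _ => ?_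
    ring

lemma ana_syn (r : ℝ) (hr : 1 < r) (a : U → 𝕜) : ana U 𝕜 r (syn U 𝕜 r a) = a := by
  funext u
  have hc := Real.HolderConjugate.conjExponent hr
  show ((2 ^ (-(Fintype.card U : ℝ) / r.conjExponent) : ℝ) : 𝕜) * ∑ ω : U → Bool, (sg (ω u) : 𝕜) * 
    (((2 ^ (-(Fintype.card U : ℝ) / r) : ℝ) : 𝕜) * ∑ u, (sg (ω u) : 𝕜) * a u) = a u
  have e : ∑ ω : U → Bool, (sg (ω u) : 𝕜) * (((2 ^ (-(Fintype.card U : ℝ) / r) : ℝ) : 𝕜) * ∑ u, (sg (ω u) : 𝕜) * a u)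
     = ((2 ^ (-(Fintype.card U : ℝ) / r) : ℝ) : 𝕜) * ((2:ℝ) ^ (Fintype.card U) : ℝ) * a u := by
    calc _ = ((2 ^ (-(Fintype.card U : ℝ) / r) : ℝ) : 𝕜) * ∑ v, ((∑ ω : U → Bool, sg (ω u) * sg (ω v) : ℝ) : 𝕜) * a v := by
          simp only [Finset.mul_sum, RCLike.ofReal_sum, Finset.sum_mul]
          rw [Finset.sum_comm]
          refine Finset.sum_congr rfl fun v _ => Finset.sum_congr rfl fun ω _ => ?_
          push_cast; ring
      _ = _ := by
          simp only [rad_orth]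
          rw [Finset.sum_eq_single u]
          · rw [if_pos rfl]; push_cast; ring
          · intro v _ hv; rw [if_neg (Ne.symm hv)]; simp
          · intro h; exact absurd (Finset.mem_univ _) h
  rw [e, ← mul_assoc, ← mul_assoc, ← RCLike.ofReal_mul, ← RCLike.ofReal_mul, ← Real.rpow_natCast, ← Real.rpow_add (by norm_num),
    ← Real.rpow_add (by norm_num)]
  have : -(Fintype.card U : ℝ) / r.conjExponent + -(Fintype.card U : ℝ) / r + Fintype.card U = 0 := by
    have h := hc.inv_add_inv_eq_one
    rw [div_eq_mul_inv, div_eq_mul_inv]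
    linear_combination (-(Fintype.card U : ℝ)) * h
  rw [this]; simp

end

lemma syn_bd (r : ℝ) (hr : 1 < r) : ∃ C : ℝ, 0 < C ∧ ∀ (U : Type) [Fintype U] [DecidableEq U] (a : U → 𝕜), 
    ∑ ω, ‖syn U 𝕜 r a ω‖ ^ r ≤ (C * Real.sqrt (∑ u, ‖a u‖ ^ 2)) ^ r := by
  have h0 : 0 < r := by linarith
  obtain ⟨C, hC, h⟩ := khin (𝕜 := 𝕜) r h0
  refine ⟨C, hC, fun U _ _ a => ?_⟩
  have h1 := h U a
  calc _ = ∑ ω : U → Bool, (2:ℝ)^(-(Fintype.card U : ℝ)) * ‖∑ u, (sg (ω u) : 𝕜) * a u‖ ^ r := by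
        refine Finset.sum_congr rfl fun ω _ => ?_
        show ‖((2 ^ (-(Fintype.card U : ℝ) / r) : ℝ) : 𝕜) * ∑ u, (sg (ω u) : 𝕜) * a u‖ ^ r = _
        rw [norm_mul, Real.mul_rpow (norm_nonneg _) (norm_nonneg _), RCLike.norm_ofReal, abs_of_nonneg (by positivity),
          ← Real.rpow_mul (by norm_num), div_mul_cancel₀ _ h0.ne']
    _ ≤ (2:ℝ)^(-(Fintype.card U : ℝ)) * (2 ^ Fintype.card U * (C * Real.sqrt (∑ u, ‖a u‖ ^ 2)) ^ r) := by
        rw [← Finset.mul_sum]; gcongr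
    _ = _ := by
        rw [← mul_assoc, ← Real.rpow_natCast, ← Real.rpow_add (by norm_num)]; simp

/-- conj trick -/
lemma sq_le_of_pair {ι : Type} [Fintype ι] (x : ι → 𝕜) (N : ℝ) (hN : 0 ≤ N)
    (h : ∀ ξ : ι → 𝕜, ‖∑ i, ξ i * x i‖ ≤ N * Real.sqrt (∑ i, ‖ξ i‖ ^ 2)) : ∑ i, ‖x i‖ ^ 2 ≤ N ^ 2 := by
  set S := ∑ i, ‖x i‖ ^ 2 with hS
  have hS0 : 0 ≤ S := by positivity
  have h1 := h (fun i => starRingEnd 𝕜 (x i))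
  have e : ∑ i, starRingEnd 𝕜 (x i) * x i = (S : 𝕜) := by
    rw [hS]; push_cast
    refine Finset.sum_congr rfl fun i _ => ?_
    rw [RCLike.conj_mul]
  simp only [e, RCLike.norm_conj, ← hS] at h1
  rw [RCLike.norm_ofReal, abs_of_nonneg hS0] at h1
  have h2 := Real.mul_self_sqrt hS0
  rcases (Real.sqrt_nonneg S).eq_or_lt with h3 | h3
  · rw [← h3] at h2; nlinarith
  · have : Real.sqrt S ≤ N := by
      nlinarith
    nlinarith

lemma ana_bd (r : ℝ) (hr : 1 < r) : ∃ C : ℝ, 0 < C ∧ ∀ (U : Type) [Fintype U] [DecidableEq U] (g : (U → Bool) → 𝕜), 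
    Real.sqrt (∑ u, ‖ana U 𝕜 r g u‖ ^ 2) ≤ C * (∑ ω, ‖g ω‖ ^ r) ^ (1/r) := by
  have hc := Real.HolderConjugate.conjExponent hr
  obtain ⟨C, hC, h⟩ := syn_bd (𝕜 := 𝕜) r.conjExponent hc.symm.lt
  refine ⟨C, hC, fun U _ _ g => ?_⟩
  refine Real.sqrt_le_iff.mpr ⟨by positivity, ?_⟩
  refine sq_le_of_pair _ _ (by positivity) fun ξ => ?_
  have e : ∑ u, ξ u * ana U 𝕜 r g u = ∑ ω, syn U 𝕜 r.conjExponent ξ ω * g ω := by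
    show ∑ u, ξ u * (((2 ^ (-(Fintype.card U : ℝ) / r.conjExponent) : ℝ) : 𝕜) * ∑ ω : U → Bool, (sg (ω u) : 𝕜) * g ω) =
      ∑ ω : U → Bool, (((2 ^ (-(Fintype.card U : ℝ) / r.conjExponent) : ℝ) : 𝕜) * ∑ u, (sg (ω u) : 𝕜) * ξ u) * g ω
    simp only [Finset.mul_sum, Finset.sum_mul]
    rw [Finset.sum_comm]
    refine Finset.sum_congr rfl fun v _ => Finset.sum_congr rfl fun ω _ => ?_
    ring
  rw [e]
  calc _ ≤ ∑ ω, ‖syn U 𝕜 r.conjExponent ξ ω‖ * ‖g ω‖ := by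
        refine (norm_sum_le _ _).trans ?_
        simp_rw [norm_mul]; rfl
    _ ≤ (∑ ω, ‖syn U 𝕜 r.conjExponent ξ ω‖ ^ r.conjExponent) ^ (1/r.conjExponent) * (∑ ω, ‖g ω‖ ^ r) ^ (1/r) := by
        have := Real.inner_le_Lp_mul_Lq Finset.univ (fun ω => ‖syn U 𝕜 r.conjExponent ξ ω‖) (fun ω => ‖g ω‖) hc.symm
        simpa using this
    _ ≤ (C * Real.sqrt (∑ u, ‖ξ u‖ ^ 2)) * (∑ ω, ‖g ω‖ ^ r) ^ (1/r) := by
        gcongr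
        have h1 := Real.rpow_le_rpow (by positivity) (h U ξ) (show 0 ≤ 1/r.conjExponent from by have := hc.symm.pos; positivity)
        rwa [← Real.rpow_mul (by positivity), mul_one_div_cancel hc.symm.pos.ne', Real.rpow_one] at h1
    _ = _ := by ring

end SzA

namespace SzA
variable {𝕜 : Type*} [RCLike 𝕜]

section
variable {W : ℕ × ℕ → Type} [∀ b, Fintype (W b)] [∀ b, DecidableEq (W b)] (e : (Σ b, W b) ≃ ℕ)

def asm (h : ∀ b, W b → 𝕜) : ℕ → 𝕜 := fun n => h (e.symm n).1 (e.symm n).2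

lemma asm_e (h : ∀ b, W b → 𝕜) (b) (w : W b) : asm e h (e ⟨b, w⟩) = h b w := by
  show (fun x : Σ b, W b => h x.1 x.2) (e.symm (e ⟨b, w⟩)) = h b w
  rw [Equiv.symm_apply_apply]

lemma asm_sum (h : ∀ b, W b → 𝕜) (r M : ℝ) (hM : ∀ s : Finset (ℕ × ℕ), ∑ b ∈ s, ∑ w, ‖h b w‖ ^ r ≤ M)
    (t : Finset ℕ) : ∑ n ∈ t, ‖asm e h n‖ ^ r ≤ M := by
  refine le_trans ?_ (hM ((t.map e.symm.toEmbedding).image Sigma.fst))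
  rw [Finset.sum_sigma']
  have : ∑ n ∈ t, ‖asm e h n‖ ^ r = ∑ x ∈ t.map e.symm.toEmbedding, ‖h x.1 x.2‖ ^ r := by
    rw [Finset.sum_map]; rfl
  rw [this]
  refine Finset.sum_le_sum_of_subset_of_nonneg ?_ fun _ _ _ => by positivity
  intro x hx
  simp only [Finset.mem_sigma, Finset.mem_univ, and_true]
  exact Finset.mem_image_of_mem _ hx

lemma exists_asm (p : ℝ≥0∞) [Fact (1 ≤ p)] (hp : p < ⊤) (h : ∀ b, W b → 𝕜) (M : ℝ) (hM0 : 0 ≤ M)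
    (hM : ∀ s : Finset (ℕ × ℕ), ∑ b ∈ s, ∑ w, ‖h b w‖ ^ p.toReal ≤ M ^ p.toReal) :
    ∃ x : lp (fun _ : ℕ => 𝕜) p, ‖x‖ ≤ M ∧ ∀ n, x n = asm e h n := by
  have hp1 : 1 ≤ p := Fact.out
  have hp0 : 0 < p.toReal := ENNReal.toReal_pos (by positivity) hp.ne
  have h1 := asm_sum e h p.toReal _ hM
  refine ⟨⟨asm e h, memℓp_gen' h1⟩, ?_, fun n => rfl⟩
  exact lp.norm_le_of_forall_sum_le hp0 hM0 h1

lemma res_sum (p : ℝ≥0∞) [Fact (1 ≤ p)] (hp : p < ⊤) (g : lp (fun _ : ℕ => 𝕜) p) (s : Finset (ℕ × ℕ)) :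
    ∑ b ∈ s, ∑ w : W b, ‖g (e ⟨b, w⟩)‖ ^ p.toReal ≤ ‖g‖ ^ p.toReal := by
  have hp1 : 1 ≤ p := Fact.out
  have hp0 : 0 < p.toReal := ENNReal.toReal_pos (by positivity) hp.ne
  rw [Finset.sum_sigma']
  have := lp.sum_rpow_le_norm_rpow hp0 g ((s.sigma fun _ => Finset.univ).map e.toEmbedding)
  rw [Finset.sum_map] at this
  exact this

lemma res_one (p : ℝ≥0∞) [Fact (1 ≤ p)] (hp : p < ⊤) (g : lp (fun _ : ℕ => 𝕜) p) (b : ℕ × ℕ) :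
    (∑ w : W b, ‖g (e ⟨b, w⟩)‖ ^ p.toReal) ^ (1 / p.toReal) ≤ ‖g‖ := by
  have hp1 : 1 ≤ p := Fact.out
  have hp0 : 0 < p.toReal := ENNReal.toReal_pos (by positivity) hp.ne
  have h := res_sum e p hp g {b}
  rw [Finset.sum_singleton] at h
  have h1 := Real.rpow_le_rpow (by positivity) h (show 0 ≤ 1/p.toReal by positivity)
  rwa [← Real.rpow_mul (by positivity), mul_one_div_cancel hp0.ne', Real.rpow_one] at h1
end

section
variable (U K : ℕ × ℕ → Type) [∀ b, Fintype (U b)] [∀ b, DecidableEq (U b)]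
  [∀ b, Fintype (K b)] [∀ b, DecidableEq (K b)] (eU : (Σ b, (U b → Bool)) ≃ ℕ) (eK : (Σ b, (K b → Bool)) ≃ ℕ)

lemma one_lt_tr {p : ℝ≥0∞} (hp : 1 < p) (hp' : p < ⊤) : 1 < p.toReal := by
  have := (ENNReal.toReal_lt_toReal (by norm_num) hp'.ne).mpr hp
  simpa using this

lemma exists_D (𝕜 : Type*) [RCLike 𝕜] (p q : ℝ≥0∞) [Fact (1 ≤ p)] [Fact (1 ≤ q)] (hp : 1 < p) (hpq : p ≤ q) (hq : q < ⊤) :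
    ∃ C : ℝ, 0 < C ∧ ∀ (M : ∀ b, (U b → 𝕜) →ₗ[𝕜] (K b → 𝕜)) (c : ℝ), 0 ≤ c → 
      (∀ b η, Real.sqrt (∑ κ, ‖M b η κ‖ ^ 2) ≤ c * Real.sqrt (∑ u, ‖η u‖ ^ 2)) → 
      ∃ D : lp (fun _ : ℕ => 𝕜) p →L[𝕜] lp (fun _ : ℕ => 𝕜) q, ‖D‖ ≤ C * c ∧ 
        ∀ g b w, D g (eK ⟨b, w⟩) = syn (K b) 𝕜 q.toReal (M b (ana (U b) 𝕜 p.toReal (fun w => g (eU ⟨b, w⟩)))) w := by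
  have hp' : p < ⊤ := hpq.trans_lt hq
  have hp1 := one_lt_tr hp hp'
  have hq1 := one_lt_tr (hp.trans_le hpq) hq
  have hpqr : p.toReal ≤ q.toReal := ENNReal.toReal_mono hq.ne hpq
  obtain ⟨C1, hC1, h1⟩ := syn_bd (𝕜 := 𝕜) q.toReal hq1
  obtain ⟨C2, hC2, h2⟩ := ana_bd (𝕜 := 𝕜) p.toReal hp1
  refine ⟨C1 * C2, by positivity, fun M c hc hM => ?_⟩
  let H : lp (fun _ : ℕ => 𝕜) p → ∀ b, (K b → Bool) → 𝕜 := fun g b => syn (K b) 𝕜 q.toReal (M b (ana (U b) 𝕜 p.toReal (fun w => g (eU ⟨b, w⟩))))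
  have hH : ∀ g, ∀ s : Finset (ℕ × ℕ), ∑ b ∈ s, ∑ w, ‖H g b w‖ ^ q.toReal ≤ (C1 * C2 * c * ‖g‖) ^ q.toReal := by
    intro g s
    let nb : ℕ × ℕ → ℝ := fun b => (∑ w : U b → Bool, ‖g (eU ⟨b, w⟩)‖ ^ p.toReal) ^ (1 / p.toReal)
    have hnb : ∀ b, 0 ≤ nb b := fun b => by positivity
    have hnb1 : ∀ b, nb b ≤ ‖g‖ := fun b => res_one eU p hp' g b
    have hnb2 : ∑ b ∈ s, nb b ^ p.toReal ≤ ‖g‖ ^ p.toReal := by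
      refine le_trans (le_of_eq ?_) (res_sum eU p hp' g s)
      refine Finset.sum_congr rfl fun b _ => ?_
      simp only [nb]
      rw [← Real.rpow_mul (by positivity), one_div_mul_cancel (by positivity), Real.rpow_one]
    have hsp : ∀ x : ℝ, 0 ≤ x → x ^ q.toReal = x ^ p.toReal * x ^ (q.toReal - p.toReal) := by
      intro x hx
      rw [← Real.rpow_add_of_nonneg hx (by positivity) (by linarith)]
      congr 1; ring
    calc _ ≤ ∑ b ∈ s, (C1 * (c * (C2 * nb b))) ^ q.toReal := by
          refine Finset.sum_le_sum fun b _ => ?_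
          refine (h1 (K b) _).trans ?_
          gcongr
          refine (hM b _).trans ?_
          gcongr
          exact h2 (U b) _
      _ = ∑ b ∈ s, (C1 * C2 * c) ^ q.toReal * (nb b ^ p.toReal * nb b ^ (q.toReal - p.toReal)) := by
          refine Finset.sum_congr rfl fun b _ => ?_
          rw [← hsp _ (hnb b), ← Real.mul_rpow (by positivity) (hnb b)]
          congr 1; ring
      _ ≤ ∑ b ∈ s, (C1 * C2 * c) ^ q.toReal * (nb b ^ p.toReal * ‖g‖ ^ (q.toReal - p.toReal)) := by
          refine Finset.sum_le_sum fun b _ => ?_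
          have := hnb b
          gcongr
          exact hnb1 b
      _ ≤ (C1 * C2 * c) ^ q.toReal * (‖g‖ ^ p.toReal * ‖g‖ ^ (q.toReal - p.toReal)) := by
          rw [← Finset.mul_sum, ← Finset.sum_mul]
          gcongr
      _ = _ := by
          rw [← hsp _ (norm_nonneg _), ← Real.mul_rpow (by positivity) (norm_nonneg _)]
  choose x hx1 hx2 using fun g => exists_asm eK q hq (H g) _ (by positivity) (hH g)
  let L : lp (fun _ : ℕ => 𝕜) p →ₗ[𝕜] lp (fun _ : ℕ => 𝕜) q := 
    { toFun := x
      map_add' := by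
        intro g g'
        ext n
        rw [lp.coeFn_add, Pi.add_apply, hx2, hx2, hx2]
        simp only [asm, H]
        have : ∀ b, (fun w => (g + g') (eU ⟨b, w⟩)) = (fun w => g (eU ⟨b, w⟩)) + fun w => g' (eU ⟨b, w⟩) := by
          intro b; funext w; simp
        rw [this, map_add, map_add, map_add]; rfl
      map_smul' := by
        intro a g
        ext n
        rw [lp.coeFn_smul, Pi.smul_apply, hx2, hx2]
        simp only [asm, H]
        have : ∀ b, (fun w => (a • g) (eU ⟨b, w⟩)) = a • (fun w => g (eU ⟨b, w⟩)) := by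
          intro b; funext w; simp
        rw [this, map_smul, map_smul, map_smul]; rfl }
  refine ⟨L.mkContinuous (C1 * C2 * c) hx1, L.mkContinuous_norm_le (by positivity) _, fun g b w => ?_⟩
  show x g (eK ⟨b, w⟩) = _
  rw [hx2, asm_e]

lemma exists_J (𝕜 : Type*) [RCLike 𝕜] (p : ℝ≥0∞) [Fact (1 ≤ p)] (hp : 1 < p) (hp' : p < ⊤) :
    ∃ C : ℝ, 0 < C ∧ ∃ J : ∀ b, (U b → 𝕜) →ₗ[𝕜] lp (fun _ : ℕ => 𝕜) p,
      (∀ b η, ‖J b η‖ ≤ C * Real.sqrt (∑ u, ‖η u‖ ^ 2)) ∧ 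
        ∀ b η w, J b η (eU ⟨b, w⟩) = syn (U b) 𝕜 p.toReal η w := by
  have hp1 := one_lt_tr hp hp'
  obtain ⟨C, hC, h1⟩ := syn_bd (𝕜 := 𝕜) p.toReal hp1
  refine ⟨C, hC, ?_⟩
  have hH : ∀ b (η : U b → 𝕜), ∀ s : Finset (ℕ × ℕ), ∑ b' ∈ s, ∑ w, ‖(Pi.single b (syn (U b) 𝕜 p.toReal η) : ∀ b', (U b' → Bool) → 𝕜) b' w‖ ^ p.toReal ≤ 
     (C * Real.sqrt (∑ u, ‖η u‖ ^ 2)) ^ p.toReal := by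
    intro b η s
    calc _ ≤ ∑ b' ∈ insert b s, ∑ w, ‖(Pi.single b (syn (U b) 𝕜 p.toReal η) : ∀ b', (U b' → Bool) → 𝕜) b' w‖ ^ p.toReal := 
          Finset.sum_le_sum_of_subset_of_nonneg (Finset.subset_insert _ _) fun _ _ _ => by positivity
      _ = ∑ w, ‖syn (U b) 𝕜 p.toReal η w‖ ^ p.toReal := by
          rw [Finset.sum_eq_single b]
          · rw [Pi.single_eq_same]
          · intro b' _ hb
            rw [Pi.single_eq_of_ne hb]
            simp [Real.zero_rpow (show p.toReal ≠ 0 by linarith)]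
          · intro h; exact absurd (Finset.mem_insert_self _ _) h
      _ ≤ _ := h1 (U b) η
  choose x hx1 hx2 using fun b η => exists_asm eU p hp' _ _ (by positivity) (hH b η)
  refine ⟨fun b => 
    { toFun := x b
      map_add' := by
        intro g g'
        ext n
        rw [lp.coeFn_add, Pi.add_apply, hx2, hx2, hx2]
        simp only [asm]
        rw [map_add, Pi.single_add]; rfl
      map_smul' := by
        intro a g
        ext n
        rw [lp.coeFn_smul, Pi.smul_apply, hx2, hx2]
        simp only [asm]
        rw [map_smul, Pi.single_smul]; rfl }, hx1, fun b η w => ?_⟩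
  show x b η (eU ⟨b, w⟩) = _
  rw [hx2, asm_e, Pi.single_eq_same]

end
end SzA

namespace SzA
variable {𝕜 : Type*} [RCLike 𝕜]

def matF {s : ℕ} (b : Blk s) (F : b.T → 𝕜) : (b.U → 𝕜) →ₗ[𝕜] (b.K → 𝕜) where
  toFun η κ := ∑ t, if b.kn t = κ then F t * η (b.un t) else 0
  map_add' x y := by
    funext κ
    rw [Pi.add_apply, ← Finset.sum_add_distrib]
    refine Finset.sum_congr rfl fun t _ => ?_
    split_ifs <;> simp [mul_add]
  map_smul' a x := by
    funext κ
    simp only [Pi.smul_apply, smul_eq_mul, RingHom.id_apply]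
    rw [Finset.mul_sum]
    refine Finset.sum_congr rfl fun t _ => ?_
    split_ifs <;> simp [mul_left_comm]

lemma matF_apply {s : ℕ} (b : Blk s) (F : b.T → 𝕜) (η κ) : matF b F η κ = ∑ t, if b.kn t = κ then F t * η (b.un t) else 0 := rfl

lemma matF_add {s : ℕ} (b : Blk s) (F G : b.T → 𝕜) (η) : matF b (F + G) η = matF b F η + matF b G η := by
  funext κ
  rw [Pi.add_apply]
  simp only [matF_apply]
  rw [← Finset.sum_add_distrib]
  refine Finset.sum_congr rfl fun t _ => ?_
  split_ifs <;> simp [add_mul]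

lemma matF_smul {s : ℕ} (b : Blk s) (a : 𝕜) (F : b.T → 𝕜) (η) : matF b (a • F) η = a • matF b F η := by
  funext κ
  rw [Pi.smul_apply]
  simp only [matF_apply, smul_eq_mul]
  rw [Finset.mul_sum]
  refine Finset.sum_congr rfl fun t _ => ?_
  split_ifs <;> simp [mul_assoc]

lemma matF_bd {s : ℕ} (b : Blk s) (F : b.T → 𝕜) (c : ℝ) (hc : 0 ≤ c) (h : OpB b F c) (η) :
    Real.sqrt (∑ κ, ‖matF b F η κ‖ ^ 2) ≤ Real.sqrt c * Real.sqrt (∑ u, ‖η u‖ ^ 2) := by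
  refine Real.sqrt_le_iff.mpr ⟨by positivity, ?_⟩
  refine sq_le_of_pair _ _ (by positivity) fun ξ => ?_
  have e : ∑ κ, ξ κ * matF b F η κ = ∑ t, F t * ξ (b.kn t) * η (b.un t) := by
    simp only [matF_apply, Finset.mul_sum]
    rw [Finset.sum_comm]
    refine Finset.sum_congr rfl fun t _ => ?_
    rw [Finset.sum_eq_single (b.kn t)]
    · rw [if_pos rfl]; ring
    · intro κ _ hk; rw [if_neg (Ne.symm hk), mul_zero]
    · intro h; exact absurd (Finset.mem_univ _) h
  rw [e]
  refine abs_le_of_sq_le_sq' ?_ (by positivity) |>.2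
  refine (h ξ η).trans (le_of_eq ?_)
  rw [mul_pow, mul_pow, Real.sq_sqrt hc, Real.sq_sqrt (by positivity), Real.sq_sqrt (by positivity)]
  ring

lemma matF_entry (k : ℕ) (F : (blk k 0).T → 𝕜) (t) :
    matF (blk k 0) F (Pi.single ((blk k 0).un t) 1) ((blk k 0).kn t) = F t := by
  rw [matF_apply, Finset.sum_eq_single t]
  · simp
  · intro t' _ ht
    split_ifs with h
    · rw [Pi.single_eq_of_ne, mul_zero]
      intro h2
      exact ht (blk_inj k 0 _ _ h h2)
    · rfl
  · intro h; exact absurd (Finset.mem_univ _) h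

lemma RC_of_mat {b : Blk 0} (inj : ∀ t t' : b.T, b.kn t = b.kn t' → b.un t = b.un t' → t = t') (M : (b.U → 𝕜) →ₗ[𝕜] (b.K → 𝕜)) (N : ℝ) (hN : 0 ≤ N)
    (h : ∀ η, Real.sqrt (∑ κ, ‖M η κ‖ ^ 2) ≤ N * Real.sqrt (∑ u, ‖η u‖ ^ 2)) :
    RC b (fun t => M (Pi.single (b.un t) 1) (b.kn t)) N := by
  have hent : ∀ η κ, ‖M η κ‖ ≤ Real.sqrt (∑ κ, ‖M η κ‖ ^ 2) := by
    intro η κ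
    refine Real.le_sqrt_of_sq_le ?_
    exact Finset.single_le_sum (f := fun κ => ‖M η κ‖ ^ 2) (fun _ _ => by positivity) (Finset.mem_univ κ)
  constructor
  · intro κ
    have h1 : ∑ u, ‖M (Pi.single u 1) κ‖ ^ 2 ≤ N ^ 2 := by
      refine sq_le_of_pair _ _ hN fun ξ => ?_
      have : ∑ u, ξ u * M (Pi.single u 1) κ = M ξ κ := by
        conv_rhs => rw [pi_eq_sum_univ' ξ]
        rw [map_sum, Finset.sum_apply]
        refine Finset.sum_congr rfl fun u _ => ?_
        rw [map_smul, Pi.smul_apply, smul_eq_mul]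
      rw [this]
      exact (hent ξ κ).trans (h ξ)
    refine le_trans ?_ h1
    rw [← Finset.sum_filter]
    have : ∑ t ∈ Finset.univ.filter (fun t => b.kn t = κ), ‖M (Pi.single (b.un t) 1) (b.kn t)‖ ^ 2 = 
       ∑ u ∈ (Finset.univ.filter (fun t => b.kn t = κ)).image b.un, ‖M (Pi.single u 1) κ‖ ^ 2 := by
      rw [Finset.sum_image]
      · refine Finset.sum_congr rfl fun t ht => ?_
        rw [(Finset.mem_filter.mp ht).2]
      · intro t ht t' ht' hu
        have e1 := (Finset.mem_filter.mp (Finset.mem_coe.mp ht)).2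
        have e2 := (Finset.mem_filter.mp (Finset.mem_coe.mp ht')).2
        exact inj _ _ (e1.trans e2.symm) hu
    rw [this]
    exact Finset.sum_le_sum_of_subset_of_nonneg (Finset.subset_univ _) fun _ _ _ => by positivity
  · intro w
    have h1 : ∑ κ, ‖M (Pi.single w 1) κ‖ ^ 2 ≤ N ^ 2 := by
      have h2 := h (Pi.single w 1)
      have e : ∑ u, ‖(Pi.single w 1 : b.U → 𝕜) u‖ ^ 2 = 1 := by
        rw [Finset.sum_eq_single w]
        · simp
        · intro v _ hv; simp [Pi.single_eq_of_ne hv]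
        · intro h; exact absurd (Finset.mem_univ _) h
      rw [e, Real.sqrt_one, mul_one] at h2
      exact (Real.sqrt_le_left hN).mp h2
    refine le_trans ?_ h1
    rw [← Finset.sum_filter]
    have : ∑ t ∈ Finset.univ.filter (fun t => b.un t = w), ‖M (Pi.single (b.un t) 1) (b.kn t)‖ ^ 2 = 
       ∑ κ ∈ (Finset.univ.filter (fun t => b.un t = w)).image b.kn, ‖M (Pi.single w 1) κ‖ ^ 2 := by
      rw [Finset.sum_image]
      · refine Finset.sum_congr rfl fun t ht => ?_
        rw [(Finset.mem_filter.mp ht).2]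
      · intro t ht t' ht' hu
        have e1 := (Finset.mem_filter.mp (Finset.mem_coe.mp ht)).2
        have e2 := (Finset.mem_filter.mp (Finset.mem_coe.mp ht')).2
        exact inj _ _ hu (e1.trans e2.symm)
    rw [this]
    exact Finset.sum_le_sum_of_subset_of_nonneg (Finset.subset_univ _) fun _ _ _ => by positivity

lemma lp_coord_zero (q : ℝ≥0∞) [Fact (1 ≤ q)] (hq : q < ⊤) (x : lp (fun _ : ℕ => 𝕜) q) (δ : ℝ) (hδ : 0 < δ) :
    {n | δ ≤ ‖x n‖}.Finite := by
  have hq1 : 1 ≤ q := Fact.out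
  have hq0 : 0 < q.toReal := ENNReal.toReal_pos (by positivity) hq.ne
  have h := ((lp.memℓp x).summable hq0).tendsto_cofinite_zero
  have h2 := h.eventually (gt_mem_nhds (show (0:ℝ) < δ ^ q.toReal by positivity))
  rw [Filter.eventually_cofinite] at h2
  refine h2.subset fun n hn => ?_
  simp only [Set.mem_ofPred_eq, not_lt] at hn ⊢
  gcongr

lemma compact_coord {E : Type*} [NormedAddCommGroup E] [NormedSpace 𝕜 E] (q : ℝ≥0∞) [Fact (1 ≤ q)] (hq : q < ⊤)
    (y : E →L[𝕜] lp (fun _ : ℕ => 𝕜) q) (hy : IsCompactOperator y) (x : ℕ → E) (R : ℝ) (hx : ∀ n, ‖x n‖ ≤ R)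
    (m : ℕ → ℕ) (hm : Function.Injective m) : Filter.Tendsto (fun n => y (x n) (m n)) Filter.cofinite (nhds 0) := by
  have hc : IsCompact (closure (y '' Metric.closedBall 0 R)) := 
    hy.isCompact_closure_image_closedBall R
  rw [Metric.tendsto_nhds]
  intro δ hδ
  obtain ⟨t, htf, htc⟩ := Metric.totallyBounded_iff.mp hc.totallyBounded (δ/2) (by positivity)
  rw [Filter.eventually_cofinite]
  have hfin : (⋃ z ∈ t, {n | δ/2 ≤ ‖z n‖}).Finite := htf.biUnion fun z _ => lp_coord_zero q hq z _ (by positivity)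
  refine (hfin.preimage hm.injOn).subset fun n hn => ?_
  have hmem : y (x n) ∈ closure (y '' Metric.closedBall 0 R) := 
    subset_closure ⟨x n, by simpa using hx n, rfl⟩
  obtain ⟨z, hz, hd⟩ := Set.mem_iUnion₂.mp (htc hmem)
  refine Set.mem_iUnion₂.mpr ⟨z, hz, ?_⟩
  simp only [Set.mem_ofPred_eq, dist_zero_right, not_lt] at hn ⊢
  rw [Metric.mem_ball, dist_eq_norm] at hd
  have hq1 : 1 ≤ q := Fact.out
  have h1 := lp.norm_apply_le_norm (p := q) (by positivity) (y (x n) - z) (m n)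
  rw [lp.coeFn_sub, Pi.sub_apply] at h1
  have h2 := norm_sub_norm_le (y (x n) (m n)) (z (m n))
  linarith

lemma exists_ulim {V : Type*} [AddCommGroup V] [Module 𝕜 V] (𝒰 : Ultrafilter ℕ) (f : ℕ → V →ₗ[𝕜] 𝕜)
    (hf : ∀ v, ∃ B : ℝ, ∀ n, ‖f n v‖ ≤ B) : ∃ g : V →ₗ[𝕜] 𝕜, ∀ v, Filter.Tendsto (fun n => f n v) 𝒰 (nhds (g v)) := by
  have : ∀ v, ∃ l, Filter.Tendsto (fun n => f n v) 𝒰 (nhds l) := by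
    intro v
    obtain ⟨B, hB⟩ := hf v
    obtain ⟨l, _, hl⟩ := (isCompact_closedBall (0:𝕜) B).ultrafilter_le_nhds (𝒰.map fun n => f n v) (by
      rw [Filter.le_principal_iff]
      exact Filter.mem_map.mpr (Filter.univ_mem' fun n => by simpa using hB n))
    exact ⟨l, hl⟩
  choose g hg using this
  refine ⟨{ toFun := g, map_add' := fun v w => ?_, map_smul' := fun a v => ?_ }, hg⟩
  · refine tendsto_nhds_unique (hg (v+w)) ?_
    simpa using (hg v).add (hg w)
  · refine tendsto_nhds_unique (hg (a • v)) ?_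
    simpa using (hg v).const_mul a

lemma RC_lim {s : ℕ} {b : Blk s} (𝒰 : Ultrafilter ℕ) (f : ℕ → b.T → 𝕜) (g : b.T → 𝕜) (R : ℝ) (hf : ∀ n, RC b (f n) R)
    (h : ∀ t, Filter.Tendsto (fun n => f n t) 𝒰 (nhds (g t))) : RC b g R := by
  have key : ∀ P : b.T → Prop, ∀ _ : DecidablePred P, Filter.Tendsto (fun n => ∑ t, (if P t then ‖f n t‖^2 else 0)) 𝒰 (nhds (∑ t, (if P t then ‖g t‖^2 else 0))) := by
    intro P _
    refine tendsto_finsetSum _ fun t _ => ?_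
    split_ifs
    · exact (h t).norm.pow 2
    · exact tendsto_const_nhds
  exact ⟨fun κ => le_of_tendsto (key _ _) (Filter.Eventually.of_forall fun n => (hf n).1 κ),
    fun κ => le_of_tendsto (key _ _) (Filter.Eventually.of_forall fun n => (hf n).2 κ)⟩

lemma RC_quot {s : ℕ} {b : Blk s} {V : Type*} [SeminormedAddCommGroup V] [NormedSpace 𝕜 V] (S : Submodule 𝕜 V)
    (L : V →ₗ[𝕜] (b.T → 𝕜)) (hS : S ≤ LinearMap.ker L) (N : ℝ) (hN : 0 ≤ N) (h : ∀ v, RC b (L v) (N * ‖v‖)) (x : V ⧸ S) :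
    RC b (S.liftQ L hS x) (N * ‖x‖) := by
  have key : ∀ δ : ℝ, 0 < δ → RC b (S.liftQ L hS x) (N * (‖x‖ + δ)) := by
    intro δ hδ
    obtain ⟨v, hv, hlt⟩ := Submodule.Quotient.norm_mk_lt (S := S) x hδ
    rw [← hv, Submodule.liftQ_apply, hv]
    exact RC_mono (h v) (by positivity) (by gcongr)
  have ht : Filter.Tendsto (fun δ : ℝ => (N * (‖x‖ + δ)) ^ 2) (nhdsWithin 0 (Set.Ioi 0)) (nhds ((N * ‖x‖)^2)) := by
    have : Continuous (fun δ : ℝ => (N * (‖x‖ + δ)) ^ 2) := by fun_prop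
    have := this.tendsto 0
    rw [add_zero] at this
    exact this.mono_left nhdsWithin_le_nhds
  exact ⟨fun κ => ge_of_tendsto ht (Filter.eventually_of_mem self_mem_nhdsWithin fun δ hδ => (key δ hδ).1 κ),
    fun κ => ge_of_tendsto ht (Filter.eventually_of_mem self_mem_nhdsWithin fun δ hδ => (key δ hδ).2 κ)⟩

lemma OpB_add {s : ℕ} {b : Blk s} {F G : b.T → 𝕜} {c d : ℝ} (hF : OpB b F c) (hG : OpB b G d) : OpB b (F + G) (2 * (c + d)) := by
  intro ξ η
  have e : ∑ t, (F + G) t * ξ (b.kn t) * η (b.un t) = ∑ t, F t * ξ (b.kn t) * η (b.un t) + ∑ t, G t * ξ (b.kn t) * η (b.un t) := by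
    rw [← Finset.sum_add_distrib]
    refine Finset.sum_congr rfl fun t _ => ?_
    simp [add_mul]
  rw [e]
  have h1 := hF ξ η
  have h2 := hG ξ η
  set x := ∑ t, F t * ξ (b.kn t) * η (b.un t)
  set y := ∑ t, G t * ξ (b.kn t) * η (b.un t)
  have h3 := norm_add_le x y
  have h4 : ‖x + y‖^2 ≤ (‖x‖ + ‖y‖)^2 := by gcongr
  nlinarith [sq_nonneg (‖x‖ - ‖y‖)]

def Bdd (𝕜 : Type*) [RCLike 𝕜] : Submodule 𝕜 (Fam 𝕜 0) where
  carrier := {F | ∃ c, 0 ≤ c ∧ ∀ k, OpB (blk k 0) (F k) c}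
  add_mem' := by
    rintro F G ⟨c, hc, h⟩ ⟨d, hd, h'⟩
    exact ⟨2 * (c + d), by positivity, fun k => OpB_add (h k) (h' k)⟩
  zero_mem' := ⟨0, le_rfl, fun k ξ η => by simp⟩
  smul_mem' := by
    rintro a F ⟨c, hc, h⟩
    exact ⟨‖a‖^2 * c, by positivity, fun k => OpB_smul (h k) a⟩

end SzA

namespace SzA

lemma exists_equiv (W : ℕ × ℕ → Type) [∀ b, Fintype (W b)] : Nonempty ((Σ b, (W b → Bool)) ≃ ℕ) := by
  classical
  have : Infinite (Σ b, (W b → Bool)) := 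
    Infinite.of_injective (fun b : ℕ × ℕ => (⟨b, fun _ => false⟩ : Σ b, (W b → Bool))) (fun b b' h => (Sigma.mk.inj h).1)
  exact nonempty_equiv_of_countable

theorem main (𝕜 : Type*) [RCLike 𝕜] (p q : ℝ≥0∞)
    [Fact (1 ≤ p)] [Fact (1 ≤ q)] (hp : 1 < p) (hpq : p ≤ q) (hq : q < ⊤)
    (E F : Type*) [NormedAddCommGroup E] [NormedSpace 𝕜 E] [CompleteSpace E]
    [NormedAddCommGroup F] [NormedSpace 𝕜 F] [CompleteSpace F]
    (hE : ∃ (A : lp (fun _ : ℕ => 𝕜) p →L[𝕜] E) (B : E →L[𝕜] lp (fun _ : ℕ => 𝕜) p),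
      B.comp A = ContinuousLinearMap.id 𝕜 (lp (fun _ : ℕ => 𝕜) p))
    (hF : ∃ (A : lp (fun _ : ℕ => 𝕜) q →L[𝕜] F) (B : F →L[𝕜] lp (fun _ : ℕ => 𝕜) q),
      B.comp A = ContinuousLinearMap.id 𝕜 (lp (fun _ : ℕ => 𝕜) q)) :
    ¬ HasAP 𝕜 ((E →L[𝕜] F) ⧸ compactOperator (RingHom.id 𝕜) E F) := by
  have hp' : p < ⊤ := hpq.trans_lt hq
  have hp1 := one_lt_tr hp hp'
  have hq1 := one_lt_tr (hp.trans_le hpq) hq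
  obtain ⟨AE, BE, hE⟩ := hE
  obtain ⟨AF, BF, hF⟩ := hF
  have hE' : ∀ x, BE (AE x) = x := fun x => congrArg (fun L : lp (fun _ : ℕ => 𝕜) p →L[𝕜] lp (fun _ : ℕ => 𝕜) p => L x) hE
  have hF' : ∀ x, BF (AF x) = x := fun x => congrArg (fun L : lp (fun _ : ℕ => 𝕜) q →L[𝕜] lp (fun _ : ℕ => 𝕜) q => L x) hF
  let U : ℕ × ℕ → Type := fun b => (blk b.1 0).U
  let K : ℕ × ℕ → Type := fun b => (blk b.1 0).K
  let _ : ∀ b, Fintype (U b) := fun b => (blk b.1 0).fU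
  let _ : ∀ b, Fintype (K b) := fun b => (blk b.1 0).fK
  let _ : ∀ b, DecidableEq (U b) := fun b => (blk b.1 0).dU
  let _ : ∀ b, DecidableEq (K b) := fun b => (blk b.1 0).dK
  obtain ⟨eU⟩ := exists_equiv U
  obtain ⟨eK⟩ := exists_equiv K
  obtain ⟨C1, hC1, hD⟩ := exists_D U K eU eK 𝕜 p q hp hpq hq
  obtain ⟨C2, hC2, J, hJ1, hJ2⟩ := exists_J U eU 𝕜 p hp hp'
  obtain ⟨C3, hC3, hana⟩ := ana_bd (𝕜 := 𝕜) q.toReal hq1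
  set S := compactOperator (RingHom.id 𝕜) E F with hS
  have hScl : IsClosed (S : Set (E →L[𝕜] F)) := isClosed_setOfPred_isCompactOperator
  have : T2Space ((E →L[𝕜] F) ⧸ S) := by
    have h3 : IsClosed (S : Set (E →L[𝕜] F)) := hScl
    have := Submodule.t3_quotient_of_isClosed S
    infer_instance
  -- iota
  have hD2 : ∀ G : Bdd 𝕜, ∃ D : lp (fun _ : ℕ => 𝕜) p →L[𝕜] lp (fun _ : ℕ => 𝕜) q, 
      ∀ g b w, D g (eK ⟨b, w⟩) = syn (K b) 𝕜 q.toReal (matF (blk b.1 0) (G.1 b.1) (ana (U b) 𝕜 p.toReal (fun w => g (eU ⟨b, w⟩)))) w := by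
    rintro ⟨G, c, hc, h⟩
    obtain ⟨D, _, h2⟩ := hD (fun b => matF (blk b.1 0) (G b.1)) (Real.sqrt c) (Real.sqrt_nonneg _) (fun b η => matF_bd _ _ c hc (h b.1) η)
    exact ⟨D, h2⟩
  choose D hDf using hD2
  have hext : ∀ x y : lp (fun _ : ℕ => 𝕜) q, (∀ b w, x (eK ⟨b, w⟩) = y (eK ⟨b, w⟩)) → x = y := by
    intro x y h
    ext n
    obtain ⟨⟨b, w⟩, rfl⟩ := eK.surjective n
    exact h b w
  have hDn : ∀ G : Bdd 𝕜, ∀ c, 0 ≤ c → (∀ k, OpB (blk k 0) (G.1 k) c) → ‖D G‖ ≤ C1 * Real.sqrt c := by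
    intro G c hc h
    obtain ⟨D', h1, h2⟩ := hD (fun b => matF (blk b.1 0) (G.1 b.1)) (Real.sqrt c) (Real.sqrt_nonneg _) (fun b η => matF_bd _ _ c hc (h b.1) η)
    have : D G = D' := by
      refine ContinuousLinearMap.ext fun g => hext _ _ fun b w => ?_
      rw [hDf, h2]
    rw [this]; exact h1
  let ι0 : Bdd 𝕜 →ₗ[𝕜] ((E →L[𝕜] F) ⧸ S) := 
    { toFun := fun G => S.mkQ (AF.comp ((D G).comp BE))
      map_add' := by
        intro G H
        have : D (G + H) = D G + D H := by
          refine ContinuousLinearMap.ext fun g => hext _ _ fun b w => ?_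
          rw [ContinuousLinearMap.add_apply, lp.coeFn_add, Pi.add_apply, hDf, hDf, hDf]
          rw [show (G + H).1 b.1 = G.1 b.1 + H.1 b.1 from rfl, matF_add, map_add, Pi.add_apply]
        rw [this, ← map_add]; congr 1
        refine ContinuousLinearMap.ext fun g => ?_
        simp
      map_smul' := by
        intro a G
        have : D (a • G) = a • D G := by
          refine ContinuousLinearMap.ext fun g => hext _ _ fun b w => ?_
          rw [ContinuousLinearMap.smul_apply, lp.coeFn_smul, Pi.smul_apply, hDf, hDf]
          rw [show (a • G).1 b.1 = a • G.1 b.1 from rfl, matF_smul, map_smul, Pi.smul_apply]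
        rw [this, ← map_smul]; congr 1
        refine ContinuousLinearMap.ext fun g => ?_
        simp }
  obtain ⟨ι, hι⟩ := LinearMap.exists_extend ι0
  have hι' : ∀ G : Bdd 𝕜, ι G.1 = S.mkQ (AF.comp ((D G).comp BE)) := fun G => congrArg (fun L => L G) hι
  -- Lambda
  let Ym : (E →L[𝕜] F) → ∀ b, (U b → 𝕜) →ₗ[𝕜] (K b → 𝕜) := fun Φ b => 
    { toFun := fun η => ana (K b) 𝕜 q.toReal (fun w => BF (Φ (AE (J b η))) (eK ⟨b, w⟩))
      map_add' := by
        intro x y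
        rw [← map_add]; congr 1; funext w; simp
      map_smul' := by
        intro a x
        rw [← map_smul]; congr 1; funext w; simp }
  have hYm : ∀ Φ b η, Ym Φ b η = ana (K b) 𝕜 q.toReal (fun w => BF (Φ (AE (J b η))) (eK ⟨b, w⟩)) := fun _ _ _ => rfl
  have hYadd : ∀ Φ Ψ b η, Ym (Φ + Ψ) b η = Ym Φ b η + Ym Ψ b η := by
    intro Φ Ψ b η
    rw [hYm, hYm, hYm, ← map_add]; congr 1; funext w; simp
  have hYsmul : ∀ (a : 𝕜) Φ b η, Ym (a • Φ) b η = a • Ym Φ b η := by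
    intro a Φ b η
    rw [hYm, hYm, ← map_smul]; congr 1; funext w; simp
  set N : ℝ := C3 * (‖BF‖ * (‖AE‖ * C2)) with hN
  have hN0 : 0 ≤ N := by positivity
  have hYb : ∀ Φ b η, Real.sqrt (∑ κ, ‖Ym Φ b η κ‖ ^ 2) ≤ (N * ‖Φ‖) * Real.sqrt (∑ u, ‖η u‖ ^ 2) := by
    intro Φ b η
    rw [hYm]
    refine (hana (K b) _).trans ?_
    have h1 := res_one eK q hq (BF (Φ (AE (J b η)))) b
    have h2 : ‖BF (Φ (AE (J b η)))‖ ≤ ‖BF‖ * (‖Φ‖ * (‖AE‖ * (C2 * Real.sqrt (∑ u, ‖η u‖ ^ 2)))) := by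
      refine (BF.le_opNorm _).trans ?_
      gcongr
      refine (Φ.le_opNorm _).trans ?_
      gcongr
      refine (AE.le_opNorm _).trans ?_
      gcongr
      exact hJ1 b η
    calc _ ≤ C3 * ‖BF (Φ (AE (J b η)))‖ := by gcongr
      _ ≤ C3 * (‖BF‖ * (‖Φ‖ * (‖AE‖ * (C2 * Real.sqrt (∑ u, ‖η u‖ ^ 2))))) := by gcongr
      _ = _ := by rw [hN]; ring
  let 𝒰 : Ultrafilter ℕ := Filter.hyperfilter ℕ
  have h𝒰 : (𝒰 : Filter ℕ) ≤ Filter.cofinite := Filter.hyperfilter_le_cofinite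
  let ent : ∀ k, (blk k 0).T → ℕ → (E →L[𝕜] F) →ₗ[𝕜] 𝕜 := fun k t n => 
    { toFun := fun Φ => Ym Φ (k, n) (Pi.single ((blk k 0).un t) 1 : (blk k 0).U → 𝕜) ((blk k 0).kn t)
      map_add' := by
        intro Φ Ψ
        exact congrFun (hYadd Φ Ψ (k, n) _) _
      map_smul' := by
        intro a Φ
        exact congrFun (hYsmul a Φ (k, n) _) _ }
  have hent : ∀ k t n Φ, ent k t n Φ = Ym Φ (k, n) (Pi.single ((blk k 0).un t) 1 : (blk k 0).U → 𝕜) ((blk k 0).kn t) := fun _ _ _ _ => rfl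
  have hRC : ∀ k n Φ, RC (blk k 0) (fun t => ent k t n Φ) (N * ‖Φ‖) := by
    intro k n Φ
    exact RC_of_mat (blk_inj k 0) (Ym Φ (k, n)) _ (by positivity) (hYb Φ (k, n))
  have hentb : ∀ k t Φ, ∃ B : ℝ, ∀ n, ‖ent k t n Φ‖ ≤ B := by
    intro k t Φ
    refine ⟨N * ‖Φ‖, fun n => ?_⟩
    refine abs_le_of_sq_le_sq' ?_ (by positivity) |>.2
    refine le_trans ?_ ((hRC k n Φ).1 ((blk k 0).kn t))
    have := Finset.single_le_sum (f := fun t' => if (blk k 0).kn t' = (blk k 0).kn t then ‖ent k t' n Φ‖ ^ 2 else 0) (fun _ _ => by positivity) (Finset.mem_univ t)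
    simpa using this
  choose lam hlam using fun k t => exists_ulim 𝒰 (ent k t) (hentb k t)
  let L : ∀ k, (E →L[𝕜] F) →ₗ[𝕜] ((blk k 0).T → 𝕜) := fun k => LinearMap.pi (lam k)
  have hLRC : ∀ k Φ, RC (blk k 0) (L k Φ) (N * ‖Φ‖) := fun k Φ => 
    RC_lim 𝒰 (fun n t => ent k t n Φ) _ _ (fun n => hRC k n Φ) (fun t => hlam k t Φ)
  have hLS : ∀ k, S ≤ LinearMap.ker (L k) := by
    intro k Φ hΦ
    have hΦ' : IsCompactOperator Φ := hΦ
    rw [LinearMap.mem_ker]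
    funext t
    refine tendsto_nhds_unique (hlam k t Φ) ?_
    have hc : IsCompactOperator (BF.comp Φ) := hΦ'.clm_comp BF
    have hz : ∀ w : (blk k 0).K → Bool, Filter.Tendsto (fun n => BF (Φ (AE (J (k, n) (Pi.single ((blk k 0).un t) 1 : (blk k 0).U → 𝕜)))) (eK ⟨(k, n), w⟩)) Filter.cofinite (nhds 0) := by
      intro w
      refine compact_coord q hq (BF.comp Φ) hc (fun n => AE (J (k, n) (Pi.single ((blk k 0).un t) 1 : (blk k 0).U → 𝕜))) (‖AE‖ * (C2 * 1)) (fun n => ?_) (fun n => eK ⟨(k, n), w⟩) ?_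
      · refine (AE.le_opNorm _).trans ?_
        gcongr
        refine (hJ1 _ _).trans ?_
        gcongr
        rw [Real.sqrt_le_one]
        show ∑ u : (blk k 0).U, ‖(Pi.single ((blk k 0).un t) 1 : (blk k 0).U → 𝕜) u‖ ^ 2 ≤ 1
        rw [Finset.sum_eq_single ((blk k 0).un t)]
        · simp
        · intro v _ hv; simp [Pi.single_eq_of_ne hv]
        · intro h; exact absurd (Finset.mem_univ _) h
      · intro n m h
        have := (Sigma.mk.inj (eK.injective h)).1
        exact (Prod.mk.inj this).2
    have hz2 : Filter.Tendsto (fun n => ent k t n Φ) Filter.cofinite (nhds 0) := by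
      have : ∀ n, ent k t n Φ = ((2 ^ (-(Fintype.card (blk k 0).K : ℝ) / q.toReal.conjExponent) : ℝ) : 𝕜) * ∑ w : (blk k 0).K → Bool, (sg (w ((blk k 0).kn t)) : 𝕜) * 
         BF (Φ (AE (J (k, n) (Pi.single ((blk k 0).un t) 1 : (blk k 0).U → 𝕜)))) (eK ⟨(k, n), w⟩) := fun n => rfl
      simp_rw [this]
      have h2 := (tendsto_finsetSum Finset.univ fun (w : (blk k 0).K → Bool) _ => (hz w).const_mul (sg (w ((blk k 0).kn t)) : 𝕜)).const_mul
        ((2 ^ (-(Fintype.card (blk k 0).K : ℝ) / q.toReal.conjExponent) : ℝ) : 𝕜)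
      simpa using h2
    exact hz2.mono_left h𝒰
  refine abstract_ap ι (‖AF‖ * (C1 * ‖BE‖)) N (by positivity) hN0 ?_ (fun k => S.liftQ (L k) (hLS k)) (fun k x => RC_quot S (L k) (hLS k) N hN0 (hLRC k) x) ?_
  · intro G c hc h
    rw [hι' ⟨G, c, hc, h⟩]
    refine (Submodule.Quotient.norm_mk_le S _).trans ?_
    have h1 := hDn ⟨G, c, hc, h⟩ c hc h
    refine (ContinuousLinearMap.opNorm_comp_le _ _).trans ?_
    rw [mul_assoc]
    gcongr
    refine (ContinuousLinearMap.opNorm_comp_le _ _).trans ?_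
    calc _ ≤ C1 * Real.sqrt c * ‖BE‖ := by gcongr
      _ = _ := by ring
  · intro G c hc h k
    rw [hι' ⟨G, c, hc, h⟩, Submodule.mkQ_apply, Submodule.liftQ_apply]
    funext t
    refine tendsto_nhds_unique (hlam k t _) ?_
    have : ∀ n, ent k t n (AF.comp ((D ⟨G, c, hc, h⟩).comp BE)) = G k t := by
      intro n
      rw [hent, hYm]
      simp only [ContinuousLinearMap.comp_apply, hE', hF', hDf, hJ2]
      have e1 : ∀ η : (blk k 0).U → 𝕜, ana (U (k,n)) 𝕜 p.toReal (fun w => syn (U (k, n)) 𝕜 p.toReal η w) = η := fun η => ana_syn _ _ hp1 η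
      rw [e1]
      have e2 : ∀ η : (blk k 0).K → 𝕜, ana (K (k,n)) 𝕜 q.toReal (fun w => syn (K (k, n)) 𝕜 q.toReal η w) = η := fun η => ana_syn _ _ hq1 η
      rw [e2]
      exact matF_entry k (G k) t
    simp_rw [this]
    exact tendsto_const_nhds

end SzA

/-- If `1 < p ≤ q < ∞` and `E`, `F` contain complemented subspaces isomorphic to `ℓ_p` and
`ℓ_q` respectively, then the quotient `L(E;F)/L_K(E;F)` fails the approximation property. -/
theorem not_ap_quotient_opSpace (𝕜 : Type*) [RCLike 𝕜] (p q : ℝ≥0∞)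
    [Fact (1 ≤ p)] [Fact (1 ≤ q)] (hp : 1 < p) (hpq : p ≤ q) (hq : q < ⊤)
    (E F : Type*) [NormedAddCommGroup E] [NormedSpace 𝕜 E] [CompleteSpace E]
    [NormedAddCommGroup F] [NormedSpace 𝕜 F] [CompleteSpace F]
    (hE : ∃ (A : lp (fun _ : ℕ => 𝕜) p →L[𝕜] E) (B : E →L[𝕜] lp (fun _ : ℕ => 𝕜) p),
      B.comp A = ContinuousLinearMap.id 𝕜 (lp (fun _ : ℕ => 𝕜) p))
    (hF : ∃ (A : lp (fun _ : ℕ => 𝕜) q →L[𝕜] F) (B : F →L[𝕜] lp (fun _ : ℕ => 𝕜) q),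
      B.comp A = ContinuousLinearMap.id 𝕜 (lp (fun _ : ℕ => 𝕜) q)) :
    ¬ HasAP 𝕜 ((E →L[𝕜] F) ⧸ compactOperator (RingHom.id 𝕜) E F) := by
  exact SzA.main 𝕜 p q hp hpq hq E F hE hF
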